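/- Let n = 2, q ≥ 2, p = q/(q−1), and let u ∈ W^{1,q}_loc(Ω) be a local weak solution of −div((|∇u|−1)_+^{q−1} ∇u/|∇u|) = f on a bounded open set Ω ⊂ ℝ². Then for every r > 2q, with δ = 1 − 2q/r ∈ (0,1), if α ∈ (δ, 1) and f ∈ B^α_{p,∞,loc}(Ω), then ∇u ∈ L^r_loc(Ω). -/

import Mathlib

open MeasureTheory Metric
open scoped RealInnerProductSpace ENNReal

/-- `H_a(ξ) = (|ξ|−1)_+^a ξ/|ξ|` (with value `0` at `ξ = 0`). -/
noncomputable def Hmap (n : ℕ) (a : ℝ) (ξ : EuclideanSpace ℝ (Fin n)) :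
    EuclideanSpace ℝ (Fin n) :=
  ((max (‖ξ‖ - 1) 0) ^ a / ‖ξ‖) • ξ

/-- The `s`-th standard unit vector `e_s` of `ℝⁿ`. -/
noncomputable def unitVec (n : ℕ) (s : Fin n) : EuclideanSpace ℝ (Fin n) :=
  EuclideanSpace.single s 1

/-- `u ∈ W^{1,q}_loc(Ω)` with weak gradient `Du`: local `L^q` integrability of `u` and `Du`,
together with the integration-by-parts identity against test functions supported in `Ω`. -/
def MemW1Loc (n : ℕ) (q : ℝ) (Ω : Set (EuclideanSpace ℝ (Fin n)))
    (u : EuclideanSpace ℝ (Fin n) → ℝ)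
    (Du : EuclideanSpace ℝ (Fin n) → EuclideanSpace ℝ (Fin n)) : Prop :=
  (∀ K : Set (EuclideanSpace ℝ (Fin n)), IsCompact K → K ⊆ Ω →
      MemLp u (ENNReal.ofReal q) (volume.restrict K) ∧
      MemLp Du (ENNReal.ofReal q) (volume.restrict K)) ∧
  (∀ φ : EuclideanSpace ℝ (Fin n) → ℝ, ContDiff ℝ 1 φ → HasCompactSupport φ →
      tsupport φ ⊆ Ω →
      ∫ x in Ω, u x • gradient φ x = -∫ x in Ω, φ x • Du x)

/-- `u` (with gradient `Du`) is a local weak solution of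
`−div((|∇u|−1)_+^{q−1} ∇u/|∇u|) = f` in `Ω`:
`∫_Ω ⟨H_{q−1}(∇u), ∇φ⟩ = ∫_Ω f φ` for all test functions `φ` supported in `Ω`. -/
def IsLocalWeakSolution (n : ℕ) (q : ℝ) (Ω : Set (EuclideanSpace ℝ (Fin n)))
    (Du : EuclideanSpace ℝ (Fin n) → EuclideanSpace ℝ (Fin n))
    (f : EuclideanSpace ℝ (Fin n) → ℝ) : Prop :=
  ∀ φ : EuclideanSpace ℝ (Fin n) → ℝ, ContDiff ℝ 1 φ → HasCompactSupport φ →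
    tsupport φ ⊆ Ω →
    ∫ x in Ω, ⟪Hmap n (q - 1) (Du x), gradient φ x⟫ = ∫ x in Ω, f x * φ x

/-- The set of Besov difference quotients of `f` on the set `B`:
`(∫_B |f(x+h e_s) − f(x)|^p / |h|^{αp} dx)^{1/p}` over directions `s` and `h ≠ 0`. -/
def besovSet (n : ℕ) (p α : ℝ) (B : Set (EuclideanSpace ℝ (Fin n)))
    (f : EuclideanSpace ℝ (Fin n) → ℝ) : Set ℝ :=
  {t : ℝ | ∃ (s : Fin n) (h : ℝ), h ≠ 0 ∧
    t = (∫ x in B, |f (x + h • unitVec n s) - f x| ^ p / |h| ^ (α * p)) ^ (1 / p)}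

/-- The Besov norm `‖f‖_{B^α_{p,∞}(B)} = ‖f‖_{L^p(B)} + sup_{h≠0} (...)^{1/p}`. -/
noncomputable def besovNormBall (n : ℕ) (p α : ℝ) (B : Set (EuclideanSpace ℝ (Fin n)))
    (f : EuclideanSpace ℝ (Fin n) → ℝ) : ℝ :=
  (∫ x in B, |f x| ^ p) ^ (1 / p) + sSup (besovSet n p α B f)

/-- `f ∈ B^α_{p,∞,loc}(Ω)`: on every ball compactly contained in `Ω`, `f ∈ L^p` and the
Besov difference quotients are bounded. -/
def MemBesovLoc (n : ℕ) (p α : ℝ) (Ω : Set (EuclideanSpace ℝ (Fin n)))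
    (f : EuclideanSpace ℝ (Fin n) → ℝ) : Prop :=
  ∀ (z : EuclideanSpace ℝ (Fin n)) (r : ℝ), 0 < r → closedBall z r ⊆ Ω →
    IntegrableOn (fun x => |f x| ^ p) (ball z r) volume ∧
    BddAbove (besovSet n p α (ball z r) f)

theorem lint_rpow_le {X : Type*} [MeasurableSpace X] (ν : Measure X) [IsProbabilityMeasure ν]
    {q : ℝ} (hq : 1 ≤ q) {F : X → ℝ≥0∞} (hF : AEMeasurable F ν) :
    (∫⁻ x, F x ∂ν) ^ q ≤ ∫⁻ x, F x ^ q ∂ν := by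
  have h := eLpNorm'_le_eLpNorm'_of_exponent_le (μ := ν) (f := F) (p := 1) (q := q) one_pos hq
    hF.aestronglyMeasurable
  simp only [eLpNorm', enorm_eq_self, ENNReal.rpow_one, one_div, inv_one] at h
  calc (∫⁻ x, F x ∂ν) ^ q ≤ ((∫⁻ x, F x ^ q ∂ν) ^ q⁻¹) ^ q := by gcongr
    _ = _ := by rw [← ENNReal.rpow_mul, inv_mul_cancel₀ (by linarith), ENNReal.rpow_one]

theorem level_step_aux {G : EuclideanSpace ℝ (Fin 2) → ℝ} (hG : Measurable G) {C s l ρ : ℝ}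
    (hs : 0 < s) (hC : 0 ≤ C) (hl : 0 < l) (hρ : 0 < ρ)
    (hdiff : ∀ z, ∫⁻ x, ‖G (x + z) - G x‖ₑ ^ 2 ≤ ENNReal.ofReal (C * ‖z‖ ^ (2 * s))) 
    (hfin : volume {x | l < |G x|} ≠ ∞)
    (hvol : volume (ball (0 : EuclideanSpace ℝ (Fin 2)) ρ) = 2 * volume {x | l < |G x|}) :
    volume {x | 2 * l < |G x|} * (ENNReal.ofReal l ^ 2 * volume {x | l < |G x|}) ≤
      ENNReal.ofReal (C * ρ ^ (2 * s)) * (2 * volume {x | l < |G x|}) := by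
  set E := {x | l < |G x|} with hE
  set E' := {x | 2 * l < |G x|} with hE'
  have hEm : MeasurableSet E := measurableSet_lt measurable_const hG.abs
  have hEm' : MeasurableSet E' := measurableSet_lt measurable_const hG.abs
  have hmeas : Measurable (fun a : EuclideanSpace ℝ (Fin 2) × EuclideanSpace ℝ (Fin 2) =>
      ‖G (a.1 + a.2) - G a.1‖ₑ ^ 2) := by fun_prop
  calc volume E' * (ENNReal.ofReal l ^ 2 * volume E)
      = ∫⁻ x in E', ENNReal.ofReal l ^ 2 * volume E := by
        rw [setLIntegral_const, mul_comm]
    _ ≤ ∫⁻ x in E', ∫⁻ z in ball 0 ρ, ‖G (x + z) - G x‖ₑ ^ 2 := by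
        refine setLIntegral_mono' hEm' fun x hx => ?_
        set S := ball (0 : EuclideanSpace ℝ (Fin 2)) ρ \ ((fun z => x + z) ⁻¹' E) with hS
        have hpre : volume ((fun z => x + z) ⁻¹' E) = volume E := measure_preimage_add _ _ _
        have h1 : volume E ≤ volume S := by
          have := le_measure_sdiff (μ := volume) (s₁ := ball (0 : EuclideanSpace ℝ (Fin 2)) ρ)
            (s₂ := ((fun z => x + z) ⁻¹' E))
          rw [hvol, hpre, two_mul, ENNReal.add_sub_cancel_right hfin] at this
          exact this
        have hSm : MeasurableSet S := measurableSet_ball.diff (hEm.preimage (by fun_prop))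
        calc ENNReal.ofReal l ^ 2 * volume E ≤ ENNReal.ofReal l ^ 2 * volume S := by gcongr
          _ = ∫⁻ z in S, ENNReal.ofReal l ^ 2 := by rw [setLIntegral_const]
          _ ≤ ∫⁻ z in S, ‖G (x + z) - G x‖ₑ ^ 2 := by
            refine setLIntegral_mono' hSm fun z hz => ?_
            gcongr
            rw [← ofReal_norm]
            apply ENNReal.ofReal_le_ofReal
            have h2 : ¬ (l < |G (x + z)|) := hz.2
            have h3 : 2 * l < |G x| := hx
            rw [Real.norm_eq_abs]
            have := abs_sub_abs_le_abs_sub (G x) (G (x + z))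
            rw [abs_sub_comm] at this
            linarith
          _ ≤ _ := lintegral_mono_set Set.sdiff_subset
    _ ≤ ∫⁻ x, ∫⁻ z in ball 0 ρ, ‖G (x + z) - G x‖ₑ ^ 2 := setLIntegral_le_lintegral _ _
    _ = ∫⁻ z in ball 0 ρ, ∫⁻ x, ‖G (x + z) - G x‖ₑ ^ 2 :=
        lintegral_lintegral_swap hmeas.aemeasurable
    _ ≤ ∫⁻ z in ball (0 : EuclideanSpace ℝ (Fin 2)) ρ, ENNReal.ofReal (C * ρ ^ (2 * s)) := by
        refine setLIntegral_mono' measurableSet_ball fun z hz => ?_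
        refine (hdiff z).trans (ENNReal.ofReal_le_ofReal ?_)
        have : ‖z‖ ≤ ρ := by simpa using (mem_ball_zero_iff.1 hz).le
        gcongr
    _ = _ := by rw [setLIntegral_const, hvol]

theorem level_step {G : EuclideanSpace ℝ (Fin 2) → ℝ} (hG : Measurable G) {C s l : ℝ}
    (hs : 0 < s) (hC : 0 ≤ C) (hl : 0 < l)
    (hdiff : ∀ z, ∫⁻ x, ‖G (x + z) - G x‖ₑ ^ 2 ≤ ENNReal.ofReal (C * ‖z‖ ^ (2 * s))) 
    (hfin : volume {x | l < |G x|} ≠ ∞) :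
    volume.real {x | 2 * l < |G x|} ≤ 2 * C * l ^ (-2 : ℝ) * volume.real {x | l < |G x|} ^ s := by
  have hsub : {x | 2 * l < |G x|} ⊆ {x | l < |G x|} := fun x hx => by
    have : 2 * l < |G x| := hx
    show l < |G x|
    linarith
  rcases eq_or_ne (volume {x | l < |G x|}) 0 with h0 | h0
  · have : volume {x | 2 * l < |G x|} = 0 := measure_mono_null hsub h0
    rw [measureReal_def, measureReal_def, this, h0]
    simp [Real.zero_rpow hs.ne']
  set m := volume.real {x | l < |G x|} with hm
  have hmpos : 0 < m := ENNReal.toReal_pos h0 hfin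
  have hme : volume {x | l < |G x|} = ENNReal.ofReal m := (ENNReal.ofReal_toReal hfin).symm
  set ρ := Real.sqrt (2 * m / Real.pi) with hρ
  have hρ2 : ρ ^ 2 = 2 * m / Real.pi := Real.sq_sqrt (by positivity)
  have hρpos : 0 < ρ := Real.sqrt_pos.2 (by positivity)
  have hvol : volume (ball (0 : EuclideanSpace ℝ (Fin 2)) ρ) = 2 * volume {x | l < |G x|} := by
    rw [EuclideanSpace.volume_ball_fin_two, hme, ← ENNReal.ofReal_pow hρpos.le,
      hρ2]
    rw [show (2 : ℝ≥0∞) = ENNReal.ofReal 2 by simp, ← ENNReal.ofReal_mul (by positivity),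
      ← ENNReal.ofReal_mul (by norm_num)]
    congr 1
    field_simp
  have key := level_step_aux hG hs hC hl hρpos hdiff hfin hvol
  have hfin' : volume {x | 2 * l < |G x|} ≠ ∞ := ne_top_of_le_ne_top hfin (measure_mono hsub)
  have key2 := ENNReal.toReal_mono (by finiteness) key
  simp only [ENNReal.toReal_mul, ENNReal.toReal_pow, ENNReal.toReal_ofNat] at key2
  rw [ENNReal.toReal_ofReal hl.le, ENNReal.toReal_ofReal (by positivity)] at key2
  change volume.real _ * (l ^ 2 * m) ≤ C * ρ ^ (2 * s) * (2 * m) at key2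
  have hρs : ρ ^ (2 * s) ≤ m ^ s := by
    rw [Real.rpow_mul hρpos.le]
    rw [Real.rpow_two, hρ2]
    apply Real.rpow_le_rpow (by positivity) _ hs.le
    rw [div_le_iff₀ Real.pi_pos]
    nlinarith [Real.pi_gt_three]
  have h4 : volume.real {x | 2 * l < |G x|} * l ^ 2 ≤ 2 * C * m ^ s := by
    have : (volume.real {x | 2 * l < |G x|} * l ^ 2) * m ≤ (2 * C * m ^ s) * m := by
      have : C * ρ ^ (2 * s) * (2 * m) ≤ C * m ^ s * (2 * m) := by gcongr
      nlinarith
    exact le_of_mul_le_mul_right this hmpos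
  rw [Real.rpow_neg hl.le, Real.rpow_two, mul_assoc, mul_comm _ (m ^ s), ← mul_assoc,
    ← div_eq_mul_inv, le_div_iff₀ (by positivity)]
  exact h4

theorem level_decay {G : EuclideanSpace ℝ (Fin 2) → ℝ} (hG : Measurable G) {C s : ℝ}
    (hs : 0 < s) (hs1 : s < 1) (hC : 0 ≤ C)
    (hdiff : ∀ z, ∫⁻ x, ‖G (x + z) - G x‖ₑ ^ 2 ≤ ENNReal.ofReal (C * ‖z‖ ^ (2 * s))) 
    (hL2 : ∫⁻ x, ‖G x‖ₑ ^ 2 ≠ ∞) :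
    (∀ k : ℕ, volume {x | (2 : ℝ) ^ k < |G x|} ≠ ∞) ∧
    ∃ M : ℝ, 0 < M ∧ ∀ k : ℕ, volume.real {x | (2 : ℝ) ^ k < |G x|} ≤
      M * ((2 : ℝ) ^ (-(2 / (1 - s)))) ^ k := by
  have hfin : ∀ k : ℕ, volume {x | (2 : ℝ) ^ k < |G x|} ≠ ∞ := by
    intro k
    have h := mul_meas_ge_le_lintegral (μ := volume) (f := fun x => ‖G x‖ₑ ^ 2) (by fun_prop) 1
    rw [one_mul] at h
    refine ne_top_of_le_ne_top hL2 ((measure_mono ?_).trans h)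
    intro x hx
    have hx : (2 : ℝ) ^ k < |G x| := hx
    have : (1 : ℝ) ≤ |G x| := (one_le_pow₀ (by norm_num)).trans hx.le
    show 1 ≤ ‖G x‖ₑ ^ 2
    apply one_le_pow₀
    rw [← ofReal_norm, ENNReal.one_le_ofReal]
    exact this
  refine ⟨hfin, ?_⟩
  set κ := 2 / (1 - s) with hκ
  have h1s : 0 < 1 - s := by linarith
  have hκe : 2 + s * κ = κ := by rw [hκ]; field_simp; ring
  set M0 := (2 * C * 2 ^ κ + 1) ^ (1 / (1 - s)) with hM0
  set M := max M0 (volume.real {x | (2 : ℝ) ^ 0 < |G x|}) with hM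
  have hM0pos : 0 < M0 := by positivity
  have hMpos : 0 < M := lt_of_lt_of_le hM0pos (le_max_left _ _)
  have hM1 : 2 * C * 2 ^ κ * M ^ s ≤ M := by
    have h5 : 2 * C * 2 ^ κ ≤ M ^ (1 - s) := by
      calc 2 * C * 2 ^ κ ≤ 2 * C * 2 ^ κ + 1 := by linarith
        _ = M0 ^ (1 - s) := by
          rw [hM0, ← Real.rpow_mul (by positivity)]
          rw [one_div, inv_mul_cancel₀ h1s.ne', Real.rpow_one]
        _ ≤ M ^ (1 - s) := Real.rpow_le_rpow hM0pos.le (le_max_left _ _) h1s.le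
    calc 2 * C * 2 ^ κ * M ^ s ≤ M ^ (1 - s) * M ^ s := by gcongr
      _ = M := by rw [← Real.rpow_add hMpos]; simp
  refine ⟨M, hMpos, fun k => ?_⟩
  induction k with
  | zero =>
    rw [pow_zero (2 ^ (-κ)), mul_one]
    exact le_max_right M0 (volume.real {x | (2 : ℝ) ^ 0 < |G x|})
  | succ k ih =>
    have hst := level_step hG (l := 2 ^ k) hs hC (by positivity) hdiff (hfin k)
    rw [pow_succ' (2 : ℝ) k]
    refine hst.trans ?_
    calc 2 * C * ((2 : ℝ) ^ k) ^ (-2 : ℝ) * volume.real {x | (2 : ℝ) ^ k < |G x|} ^ s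
        ≤ 2 * C * ((2 : ℝ) ^ k) ^ (-2 : ℝ) * (M * ((2 : ℝ) ^ (-κ)) ^ k) ^ s := by gcongr
      _ = (2 * C * 2 ^ κ * M ^ s) * ((2 : ℝ) ^ (-κ)) ^ (k + 1) := by
        rw [Real.mul_rpow hMpos.le (by positivity)]
        simp only [← Real.rpow_natCast, ← Real.rpow_mul (zero_le_two (α := ℝ))]
        have : (2 : ℝ) ^ ((k : ℝ) * -2) * 2 ^ (-κ * k * s) = 2 ^ κ * 2 ^ (-κ * ((k + 1 : ℕ) : ℝ)) := by
          rw [← Real.rpow_add two_pos, ← Real.rpow_add two_pos]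
          congr 1
          push_cast
          linear_combination (-(k : ℝ)) * hκe
        linear_combination (2 * C * M ^ s) * this
      _ ≤ M * ((2 : ℝ) ^ (-κ)) ^ (k + 1) := by gcongr

theorem exists_dyadic {y : ℝ} (hy : 1 < y) : ∃ n : ℕ, (2 : ℝ) ^ n < y ∧ y ≤ 2 ^ (n + 1) := by
  classical
  have hex : ∃ n : ℕ, y ≤ (2 : ℝ) ^ (n + 1) := by
    obtain ⟨n, hn⟩ := pow_unbounded_of_one_lt y (one_lt_two (α := ℝ))
    exact ⟨n, hn.le.trans (pow_le_pow_right₀ one_le_two (Nat.le_succ n))⟩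
  refine ⟨Nat.find hex, ?_, Nat.find_spec hex⟩
  rcases Nat.eq_zero_or_pos (Nat.find hex) with h | h
  · rw [h]; simpa using hy
  · have := Nat.find_min hex (Nat.sub_lt h one_pos)
    rw [show Nat.find hex - 1 + 1 = Nat.find hex by omega] at this
    exact not_le.1 this

theorem level_memLp {G : EuclideanSpace ℝ (Fin 2) → ℝ} (hG : Measurable G) {C s t : ℝ}
    (hs : 0 < s) (hs1 : s < 1) (hC : 0 ≤ C) (ht : 0 < t) (ht1 : t < 2 / (1 - s))
    (hdiff : ∀ z, ∫⁻ x, ‖G (x + z) - G x‖ₑ ^ 2 ≤ ENNReal.ofReal (C * ‖z‖ ^ (2 * s))) 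
    (hL2 : ∫⁻ x, ‖G x‖ₑ ^ 2 ≠ ∞) {K : Set (EuclideanSpace ℝ (Fin 2))} (hK : volume K ≠ ∞) :
    ∫⁻ x in K, ENNReal.ofReal (|G x| ^ t) ≠ ∞ := by
  obtain ⟨hfin, M, hM, hdec⟩ := level_decay hG hs hs1 hC hdiff hL2
  have hpt : ∀ x, ENNReal.ofReal (|G x| ^ t) ≤ 1 + ∑' k : ℕ,
      Set.indicator {x | (2 : ℝ) ^ k < |G x|} (fun _ => ENNReal.ofReal (((2 : ℝ) ^ (k + 1)) ^ t)) x := by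
    intro x
    by_cases h1 : |G x| ≤ 1
    · refine le_add_right ?_
      rw [ENNReal.ofReal_le_one]
      exact Real.rpow_le_one (abs_nonneg _) h1 ht.le
    · push Not at h1
      obtain ⟨n, hn1, hn2⟩ := exists_dyadic h1
      refine le_add_left (le_trans ?_ (ENNReal.le_tsum n))
      rw [Set.indicator_of_mem (show x ∈ {x | (2 : ℝ) ^ n < |G x|} from hn1)]
      apply ENNReal.ofReal_le_ofReal
      gcongr
  have hterm : ∀ k : ℕ, ENNReal.ofReal (((2 : ℝ) ^ (k + 1)) ^ t) * volume {x | (2 : ℝ) ^ k < |G x|} ≤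
      ENNReal.ofReal ((2 ^ t * M) * ((2 : ℝ) ^ (t - 2 / (1 - s))) ^ k) := by
    intro k
    rw [← ENNReal.ofReal_toReal (hfin k), ← ENNReal.ofReal_mul (by positivity)]
    apply ENNReal.ofReal_le_ofReal
    calc _ ≤ ((2 : ℝ) ^ (k + 1)) ^ t * (M * ((2 : ℝ) ^ (-(2 / (1 - s)))) ^ k) := by
          gcongr
          exact hdec k
      _ = _ := by
          have : ((2 : ℝ) ^ (k + 1)) ^ t * ((2 : ℝ) ^ (-(2 / (1 - s)))) ^ k = 
             2 ^ t * ((2 : ℝ) ^ (t - 2 / (1 - s))) ^ k := by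
            simp only [← Real.rpow_natCast, ← Real.rpow_mul (zero_le_two (α := ℝ))]
            rw [← Real.rpow_add two_pos, ← Real.rpow_add two_pos]
            congr 1
            push_cast
            ring
          linear_combination M * this
  have hsum : ∑' k : ℕ, ENNReal.ofReal ((2 ^ t * M) * ((2 : ℝ) ^ (t - 2 / (1 - s))) ^ k) ≠ ∞ := by
    apply Summable.tsum_ofReal_ne_top
    apply Summable.mul_left
    apply summable_geometric_of_lt_one (by positivity)
    apply Real.rpow_lt_one_of_one_lt_of_neg one_lt_two
    linarith
  refine ne_top_of_le_ne_top ?_ (lintegral_mono hpt)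
  have hms : ∀ k : ℕ, MeasurableSet {x | (2 : ℝ) ^ k < |G x|} :=
    fun k => measurableSet_lt measurable_const hG.abs
  rw [lintegral_add_left measurable_const, lintegral_tsum 
    (fun k => (measurable_const.indicator (hms k)).aemeasurable)]
  refine ENNReal.add_ne_top.2 ⟨by simpa using hK, ne_top_of_le_ne_top hsum ?_⟩
  refine ENNReal.tsum_le_tsum fun k => ?_
  refine le_trans ?_ (hterm k)
  refine (setLIntegral_le_lintegral _ _).trans ?_
  rw [lintegral_indicator_const (hms k)]

theorem enorm_sq_add_le {F : Type*} [NormedAddCommGroup F] (a b : F) :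
    ‖a + b‖ₑ ^ 2 ≤ 2 * (‖a‖ₑ ^ 2 + ‖b‖ₑ ^ 2) := by
  have h1 : ‖a + b‖ ^ 2 ≤ 2 * (‖a‖ ^ 2 + ‖b‖ ^ 2) := by
    have := norm_add_le a b
    nlinarith [sq_nonneg (‖a‖ - ‖b‖), norm_nonneg (a + b), norm_nonneg a, norm_nonneg b]
  simp only [← ofReal_norm]
  rw [← ENNReal.ofReal_pow (norm_nonneg _), ← ENNReal.ofReal_pow (norm_nonneg _),
    ← ENNReal.ofReal_pow (norm_nonneg _), ← ENNReal.ofReal_add (by positivity) (by positivity),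
    show (2 : ℝ≥0∞) = ENNReal.ofReal 2 by simp, ← ENNReal.ofReal_mul (by positivity)]
  exact ENNReal.ofReal_le_ofReal h1

theorem besov_embed_meas {G : EuclideanSpace ℝ (Fin 2) → ℝ} (hG : Measurable G)
    (hL2 : ∫⁻ x, ‖G x‖ₑ ^ 2 ≠ ∞) {C s t h0 : ℝ}
    (hs : 0 < s) (hs1 : s < 1) (hC : 0 ≤ C) (ht : 0 < t) (ht1 : t < 2 / (1 - s)) (hh0 : 0 < h0)
    (hdiff : ∀ (i : Fin 2) (h : ℝ), h ≠ 0 → |h| < h0 → 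
      ∫⁻ x, ‖G (x + h • unitVec 2 i) - G x‖ₑ ^ 2 ≤ ENNReal.ofReal (C * |h| ^ (2 * s))) 
    {K : Set (EuclideanSpace ℝ (Fin 2))} (hK : volume K ≠ ∞) :
    ∫⁻ x in K, ENNReal.ofReal (|G x| ^ t) ≠ ∞ := by
  set N := (∫⁻ x, ‖G x‖ₑ ^ 2).toReal with hN
  have hNe : ∫⁻ x, ‖G x‖ₑ ^ 2 = ENNReal.ofReal N := (ENNReal.ofReal_toReal hL2).symm
  have hN0 : 0 ≤ N := ENNReal.toReal_nonneg
  set C1 := C + 4 * N / h0 ^ (2 * s) with hC1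
  have hC1' : 0 ≤ C1 := by positivity
  have hd1 : ∀ (i : Fin 2) (h : ℝ), ∫⁻ x, ‖G (x + h • unitVec 2 i) - G x‖ₑ ^ 2 ≤
      ENNReal.ofReal (C1 * |h| ^ (2 * s)) := by
    intro i h
    rcases eq_or_ne h 0 with rfl | hne
    · simp
    by_cases hh : |h| < h0
    · refine (hdiff i h hne hh).trans (ENNReal.ofReal_le_ofReal ?_)
      gcongr
      rw [hC1]
      have : 0 ≤ 4 * N / h0 ^ (2 * s) := by positivity
      linarith
    · push Not at hh
      calc ∫⁻ x, ‖G (x + h • unitVec 2 i) - G x‖ₑ ^ 2 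
          ≤ ∫⁻ x, 2 * (‖G (x + h • unitVec 2 i)‖ₑ ^ 2 + ‖G x‖ₑ ^ 2) := by
            refine lintegral_mono fun x => ?_
            have := enorm_sq_add_le (G (x + h • unitVec 2 i)) (- G x)
            simpa [sub_eq_add_neg] using this
        _ = 2 * (ENNReal.ofReal N + ENNReal.ofReal N) := by
            rw [lintegral_const_mul _ (by fun_prop), lintegral_add_left (by fun_prop),
              lintegral_add_right_eq_self (fun x => ‖G x‖ₑ ^ 2) (h • unitVec 2 i), hNe]
        _ = ENNReal.ofReal (4 * N) := by
            rw [← ENNReal.ofReal_add hN0 hN0, show (2 : ℝ≥0∞) = ENNReal.ofReal 2 by simp,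
              ← ENNReal.ofReal_mul (by positivity)]
            congr 1; ring
        _ ≤ _ := by
            apply ENNReal.ofReal_le_ofReal
            have h1 : h0 ^ (2 * s) ≤ |h| ^ (2 * s) := by gcongr
            have h2 : 0 < h0 ^ (2 * s) := by positivity
            calc 4 * N = 4 * N / h0 ^ (2 * s) * h0 ^ (2 * s) := by field_simp
              _ ≤ C1 * |h| ^ (2 * s) := by
                gcongr
                rw [hC1]; linarith
  refine level_memLp hG (C := 4 * C1) hs hs1 (by positivity) ht ht1 ?_ hL2 hK
  intro z
  have hz : z = z 0 • unitVec 2 0 + z 1 • unitVec 2 1 := by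
    ext i
    fin_cases i <;> simp [unitVec]
  have hn : ∀ i, |z i| ≤ ‖z‖ := fun i => by simpa using PiLp.norm_apply_le z i
  calc ∫⁻ x, ‖G (x + z) - G x‖ₑ ^ 2 
      ≤ ∫⁻ x, 2 * (‖G ((x + z 0 • unitVec 2 0) + z 1 • unitVec 2 1) - G (x + z 0 • unitVec 2 0)‖ₑ ^ 2 
        + ‖G (x + z 0 • unitVec 2 0) - G x‖ₑ ^ 2) := by
        refine lintegral_mono fun x => ?_
        refine le_trans (le_of_eq ?_) (enorm_sq_add_le _ _)
        conv_lhs => rw [hz]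
        rw [← add_assoc]
        simp
    _ = 2 * ((∫⁻ x, ‖G (x + z 1 • unitVec 2 1) - G x‖ₑ ^ 2) + 
          ∫⁻ x, ‖G (x + z 0 • unitVec 2 0) - G x‖ₑ ^ 2) := by
        rw [lintegral_const_mul _ (by fun_prop), lintegral_add_left (by fun_prop),
          lintegral_add_right_eq_self (fun x => ‖G (x + z 1 • unitVec 2 1) - G x‖ₑ ^ 2)]
    _ ≤ 2 * (ENNReal.ofReal (C1 * ‖z‖ ^ (2 * s)) + ENNReal.ofReal (C1 * ‖z‖ ^ (2 * s))) := by
        gcongr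
        · refine (hd1 _ _).trans (ENNReal.ofReal_le_ofReal ?_)
          gcongr; exact hn 1
        · refine (hd1 _ _).trans (ENNReal.ofReal_le_ofReal ?_)
          gcongr; exact hn 0
    _ = _ := by
        have hpos : 0 ≤ ‖z‖ ^ (2 * s) := by positivity
        generalize ‖z‖ ^ (2 * s) = w at hpos
        rw [← ENNReal.ofReal_add (by positivity) (by positivity),
          ← ENNReal.ofReal_ofNat 2, ← ENNReal.ofReal_mul (by positivity)]
        congr 1; ring

theorem besov_embed {G : EuclideanSpace ℝ (Fin 2) → ℝ} (hG : AEMeasurable G)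
    (hL2 : ∫⁻ x, ‖G x‖ₑ ^ 2 ≠ ∞) {C s t h0 : ℝ}
    (hs : 0 < s) (hs1 : s < 1) (hC : 0 ≤ C) (ht : 0 < t) (ht1 : t < 2 / (1 - s)) (hh0 : 0 < h0)
    (hdiff : ∀ (i : Fin 2) (h : ℝ), h ≠ 0 → |h| < h0 → 
      ∫⁻ x, ‖G (x + h • unitVec 2 i) - G x‖ₑ ^ 2 ≤ ENNReal.ofReal (C * |h| ^ (2 * s))) 
    {K : Set (EuclideanSpace ℝ (Fin 2))} (hK : volume K ≠ ∞) :
    ∫⁻ x in K, ENNReal.ofReal (|G x| ^ t) ≠ ∞ := by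
  have hae := hG.ae_eq_mk
  have h1 : ∫⁻ x in K, ENNReal.ofReal (|G x| ^ t) = ∫⁻ x in K, ENNReal.ofReal (|hG.mk G x| ^ t) := by
    apply lintegral_congr_ae
    filter_upwards [ae_restrict_of_ae hae] with x hx
    rw [hx]
  rw [h1]
  refine besov_embed_meas hG.measurable_mk ?_ hs hs1 hC ht ht1 hh0 ?_ hK
  · rwa [← lintegral_congr_ae (f := fun x => ‖G x‖ₑ ^ 2)]
    filter_upwards [hae] with x hx
    rw [hx]
  · intro i h hne hh
    rw [← lintegral_congr_ae (f := fun x => ‖G (x + h • unitVec 2 i) - G x‖ₑ ^ 2)]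
    · exact hdiff i h hne hh
    · have h2 := (measurePreserving_add_right volume (h • unitVec 2 i)).quasiMeasurePreserving.ae hae
      filter_upwards [hae, h2] with x hx hx2
      rw [hx, hx2]

theorem rpow_sub_le {a b e : ℝ} (hb : 0 ≤ b) (hab : b ≤ a) (he : 1 ≤ e) :
    a ^ e - b ^ e ≤ e * a ^ (e - 1) * (a - b) := by
  rcases hb.eq_or_lt with rfl | hb'
  · rcases hab.eq_or_lt with rfl | ha
    · simp
    · rw [Real.zero_rpow (by linarith)]
      have : a ^ e = a ^ (e - 1) * a := by
        rw [← Real.rpow_add_one ha.ne']; simp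
      rw [this]
      have : 0 ≤ a ^ (e - 1) * a := by positivity
      nlinarith
  have ha : 0 < a := lt_of_lt_of_le hb' hab
  have h := one_add_mul_self_le_rpow_one_add (s := b / a - 1) (p := e) (by
    have : 0 ≤ b / a := by positivity
    linarith) he
  rw [add_sub_cancel, Real.div_rpow hb ha.le, le_div_iff₀ (by positivity)] at h
  have h2 : a ^ e = a ^ (e - 1) * a := by
    rw [← Real.rpow_add_one ha.ne']; simp
  have h3 : (1 + e * (b / a - 1)) * a ^ e = a ^ e - e * a ^ (e - 1) * (a - b) := by
    rw [h2]; field_simp; ring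
  linarith

theorem rpow_sub_ge {a b q : ℝ} (hb : 0 ≤ b) (hab : b ≤ a) (hq : 2 ≤ q) :
    a ^ (q - 2) * (a - b) ≤ a ^ (q - 1) - b ^ (q - 1) := by
  have h : ∀ x : ℝ, 0 ≤ x → x ^ (q - 1) = x ^ (q - 2) * x := by
    intro x hx
    rw [show q - 1 = (q - 2) + 1 by ring, Real.rpow_add_one' hx (by linarith)]
  rw [h a (hb.trans hab), h b hb]
  have : b ^ (q - 2) ≤ a ^ (q - 2) := Real.rpow_le_rpow hb hab (by linarith)
  nlinarith

theorem scal_ineq1 {a b q : ℝ} (ha : 0 ≤ a) (hb : 0 ≤ b) (hq : 2 ≤ q) :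
    (a ^ (q / 2) - b ^ (q / 2)) ^ 2 ≤ q ^ 2 * ((a ^ (q - 1) - b ^ (q - 1)) * (a - b)) := by
  wlog hab : b ≤ a generalizing a b
  · have := this hb ha (not_le.1 hab).le
    linarith
  have h1 := rpow_sub_le hb hab (e := q / 2) (by linarith)
  have h2 := rpow_sub_ge hb hab hq
  have h0 : 0 ≤ a ^ (q / 2) - b ^ (q / 2) :=
    sub_nonneg.2 (Real.rpow_le_rpow hb hab (by linarith))
  have h3 : (a ^ (q / 2 - 1)) ^ 2 = a ^ (q - 2) := by
    rw [← Real.rpow_natCast, ← Real.rpow_mul ha]; congr 1; push_cast; ring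
  calc _ ≤ (q / 2 * a ^ (q / 2 - 1) * (a - b)) ^ 2 := by gcongr
    _ = q ^ 2 / 4 * ((a ^ (q - 2) * (a - b)) * (a - b)) := by rw [← h3]; ring
    _ ≤ q ^ 2 / 4 * ((a ^ (q - 1) - b ^ (q - 1)) * (a - b)) := by
      gcongr
    _ ≤ _ := by
      have : 0 ≤ (a ^ (q - 1) - b ^ (q - 1)) * (a - b) := by
        apply mul_nonneg _ (by linarith)
        refine le_trans ?_ h2
        have := sub_nonneg.2 hab
        positivity
      nlinarith [sq_nonneg q]

theorem scal_ineq2 {a b q S : ℝ} (ha : 0 ≤ a) (hb : 0 ≤ b) (hq : 2 ≤ q) (haS : a ≤ S) (hbS : b ≤ S) :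
    (a ^ (q - 1) - b ^ (q - 1)) ^ 2 ≤ q * S ^ (q - 2) * ((a ^ (q - 1) - b ^ (q - 1)) * (a - b)) := by
  wlog hab : b ≤ a generalizing a b
  · have := this hb ha hbS haS (not_le.1 hab).le
    linarith
  have h1 := rpow_sub_le hb hab (e := q - 1) (by linarith)
  have h0 : 0 ≤ a ^ (q - 1) - b ^ (q - 1) :=
    sub_nonneg.2 (Real.rpow_le_rpow hb hab (by linarith))
  have h5 := sub_nonneg.2 hab
  have h6 : 0 ≤ q := by linarith
  have h4 : a ^ (q - 1) - b ^ (q - 1) ≤ q * S ^ (q - 2) * (a - b) := by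
    refine h1.trans ?_
    rw [show q - 1 - 1 = q - 2 by ring]
    have : a ^ (q - 2) ≤ S ^ (q - 2) := Real.rpow_le_rpow ha haS (by linarith)
    gcongr
    linarith
  calc (a ^ (q - 1) - b ^ (q - 1)) ^ 2 = (a ^ (q - 1) - b ^ (q - 1)) * (a ^ (q - 1) - b ^ (q - 1)) := sq _
    _ ≤ (a ^ (q - 1) - b ^ (q - 1)) * (q * S ^ (q - 2) * (a - b)) := by gcongr
    _ = _ := by ring

theorem scal_ineq3 {a b q S : ℝ} (ha : 0 ≤ a) (hb : 0 ≤ b) (hq : 2 ≤ q) (haS : a ≤ S) (hbS : b ≤ S) :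
    (a ^ (q - 1) + b ^ (q - 1)) ^ 2 ≤ q * S ^ (q - 2) * ((a ^ (q - 1) + b ^ (q - 1)) * (a + b)) := by
  have h : ∀ x : ℝ, 0 ≤ x → x ≤ S → x ^ (q - 1) ≤ S ^ (q - 2) * x := by
    intro x hx hxS
    rw [show q - 1 = (q - 2) + 1 by ring, Real.rpow_add_one' hx (by linarith)]
    gcongr
  have h1 := h a ha haS
  have h2 := h b hb hbS
  have hS : 0 ≤ S := ha.trans haS
  have h0 : 0 ≤ a ^ (q - 1) + b ^ (q - 1) := by positivity
  calc _ = (a ^ (q - 1) + b ^ (q - 1)) * (a ^ (q - 1) + b ^ (q - 1)) := sq _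
    _ ≤ (a ^ (q - 1) + b ^ (q - 1)) * (S ^ (q - 2) * (a + b)) := by
      gcongr; linarith
    _ = 1 * (S ^ (q - 2) * ((a ^ (q - 1) + b ^ (q - 1)) * (a + b))) := by ring
    _ ≤ q * (S ^ (q - 2) * ((a ^ (q - 1) + b ^ (q - 1)) * (a + b))) := by
      gcongr; linarith
    _ = _ := by ring

theorem hmap_ineq {n : ℕ} {q : ℝ} (hq : 2 ≤ q) (ξ ζ : EuclideanSpace ℝ (Fin n)) :
    ((max (‖ξ‖ - 1) 0) ^ (q / 2) - (max (‖ζ‖ - 1) 0) ^ (q / 2)) ^ 2 ≤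
      q ^ 2 * ⟪Hmap n (q - 1) ξ - Hmap n (q - 1) ζ, ξ - ζ⟫ ∧
    ‖Hmap n (q - 1) ξ - Hmap n (q - 1) ζ‖ ^ 2 ≤
      q * (‖ξ‖ + ‖ζ‖) ^ (q - 2) * ⟪Hmap n (q - 1) ξ - Hmap n (q - 1) ζ, ξ - ζ⟫ ∧
    0 ≤ ⟪Hmap n (q - 1) ξ - Hmap n (q - 1) ζ, ξ - ζ⟫ := by
  obtain ⟨T, hT1, hT2, hT⟩ : ∃ T : ℝ, -1 ≤ T ∧ T ≤ 1 ∧ ⟪ξ, ζ⟫ = ‖ξ‖ * ‖ζ‖ * T := by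
    have h := abs_le.1 (abs_real_inner_div_norm_mul_norm_le_one ξ ζ)
    refine ⟨_, h.1, h.2, ?_⟩
    by_cases hne : ‖ξ‖ * ‖ζ‖ = 0
    · rcases mul_eq_zero.1 hne with h | h
      · rw [norm_eq_zero.1 h]; simp
      · rw [norm_eq_zero.1 h]; simp
    · rw [mul_div_cancel₀ _ hne]
  set a := max (‖ξ‖ - 1) 0 with ha
  set b := max (‖ζ‖ - 1) 0 with hb
  have ha0 : 0 ≤ a := le_max_right _ _
  have hb0 : 0 ≤ b := le_max_right _ _
  set A := a ^ (q - 1) with hA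
  set B := b ^ (q - 1) with hB
  have hA0 : 0 ≤ A := by positivity
  have hB0 : 0 ≤ B := by positivity
  have hHx : Hmap n (q - 1) ξ = (A / ‖ξ‖) • ξ := rfl
  have hHz : Hmap n (q - 1) ζ = (B / ‖ζ‖) • ζ := rfl
  have hAz : a = 0 → A = 0 := fun h => by rw [hA, h, Real.zero_rpow (by linarith)]
  have hBz : b = 0 → B = 0 := fun h => by rw [hB, h, Real.zero_rpow (by linarith)]
  have hca : (a = 0 ∧ ‖ξ‖ ≤ 1) ∨ (‖ξ‖ = a + 1) := by
    rcases le_total ‖ξ‖ 1 with h | h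
    · left; exact ⟨by rw [ha]; exact max_eq_right (by linarith), h⟩
    · right; rw [ha, max_eq_left (by linarith)]; ring
  have hcb : (b = 0 ∧ ‖ζ‖ ≤ 1) ∨ (‖ζ‖ = b + 1) := by
    rcases le_total ‖ζ‖ 1 with h | h
    · left; exact ⟨by rw [hb]; exact max_eq_right (by linarith), h⟩
    · right; rw [hb, max_eq_left (by linarith)]; ring
  have hAm : A / ‖ξ‖ * ‖ξ‖ = A := by
    rcases hca with h | h
    · rw [hAz h.1]; simp
    · have : ‖ξ‖ ≠ 0 := by linarith
      field_simp
  have hBm : B / ‖ζ‖ * ‖ζ‖ = B := by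
    rcases hcb with h | h
    · rw [hBz h.1]; simp
    · have : ‖ζ‖ ≠ 0 := by linarith
      field_simp
  have hQ : ⟪Hmap n (q - 1) ξ - Hmap n (q - 1) ζ, ξ - ζ⟫ =
      A * ‖ξ‖ + B * ‖ζ‖ - (A * ‖ζ‖ + B * ‖ξ‖) * T := by
    rw [hHx, hHz]
    simp only [inner_sub_left, inner_sub_right, real_inner_smul_left, real_inner_self_eq_norm_sq]
    rw [real_inner_comm ξ ζ, hT]
    linear_combination (‖ξ‖ - ‖ζ‖ * T) * hAm + (‖ζ‖ - ‖ξ‖ * T) * hBm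
  have hN : ‖Hmap n (q - 1) ξ - Hmap n (q - 1) ζ‖ ^ 2 = A ^ 2 + B ^ 2 - 2 * A * B * T := by
    rw [norm_sub_sq_real, hHx, hHz]
    simp only [norm_smul, real_inner_smul_left, real_inner_smul_right, Real.norm_eq_abs, mul_pow, sq_abs]
    rw [hT]
    have e1 : (A / ‖ξ‖) ^ 2 * ‖ξ‖ ^ 2 = A ^ 2 := by rw [← mul_pow, hAm]
    have e2 : (B / ‖ζ‖) ^ 2 * ‖ζ‖ ^ 2 = B ^ 2 := by rw [← mul_pow, hBm]
    have e3 : (A / ‖ξ‖ * ‖ξ‖) * (B / ‖ζ‖ * ‖ζ‖) = A * B := by rw [hAm, hBm]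
    linear_combination e1 + e2 - 2 * T * e3
  have hQ1 : (1 + T) / 2 * ((A - B) * (a - b)) + (1 - T) / 2 * ((A + B) * (a + b)) ≤
      A * ‖ξ‖ + B * ‖ζ‖ - (A * ‖ζ‖ + B * ‖ξ‖) * T := by
    have hx0 := norm_nonneg ξ
    have hz0 := norm_nonneg ζ
    rcases hca with ⟨h, h'⟩ | h <;> rcases hcb with ⟨k, k'⟩ | k
    · rw [hAz h, hBz k]; simp
    · rw [hAz h, h, k]
      have : ‖ξ‖ * T ≤ 1 := by nlinarith
      nlinarith
    · rw [hBz k, h, k]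
      have : ‖ζ‖ * T ≤ 1 := by nlinarith
      nlinarith
    · rw [h, k]
      nlinarith [mul_nonneg hA0 (sub_nonneg.2 hT2), mul_nonneg hB0 (sub_nonneg.2 hT2)]
  have haS : a ≤ ‖ξ‖ + ‖ζ‖ := by
    have := norm_nonneg ξ
    have := norm_nonneg ζ
    rw [ha]; apply max_le <;> linarith
  have hbS : b ≤ ‖ξ‖ + ‖ζ‖ := by
    have := norm_nonneg ξ
    have := norm_nonneg ζ
    rw [hb]; apply max_le <;> linarith
  have s1 := scal_ineq1 ha0 hb0 hq
  have s2 := scal_ineq2 ha0 hb0 hq haS hbS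
  have s3 := scal_ineq3 ha0 hb0 hq haS hbS
  rw [← hA, ← hB] at s1 s2 s3
  have hP : 0 ≤ (A - B) * (a - b) := by
    have : 0 ≤ q ^ 2 * ((A - B) * (a - b)) := le_trans (sq_nonneg _) s1
    exact nonneg_of_mul_nonneg_right this (by positivity)
  have hP2 : (A - B) * (a - b) ≤ (A + B) * (a + b) := by nlinarith [mul_nonneg hA0 hb0, mul_nonneg hB0 ha0]
  rw [hQ, hN]
  set Q := A * ‖ξ‖ + B * ‖ζ‖ - (A * ‖ζ‖ + B * ‖ξ‖) * T
  have hPQ : (A - B) * (a - b) ≤ Q := by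
    have := mul_le_mul_of_nonneg_left hP2 (show 0 ≤ (1 - T) / 2 by linarith)
    linarith
  have hS : 0 ≤ q * (‖ξ‖ + ‖ζ‖) ^ (q - 2) := by positivity
  refine ⟨s1.trans (by gcongr), ?_, hP.trans hPQ⟩
  calc A ^ 2 + B ^ 2 - 2 * A * B * T = (1 + T) / 2 * (A - B) ^ 2 + (1 - T) / 2 * (A + B) ^ 2 := by ring
    _ ≤ (1 + T) / 2 * (q * (‖ξ‖ + ‖ζ‖) ^ (q - 2) * ((A - B) * (a - b))) + 
        (1 - T) / 2 * (q * (‖ξ‖ + ‖ζ‖) ^ (q - 2) * ((A + B) * (a + b))) := by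
      gcongr <;> linarith
    _ = q * (‖ξ‖ + ‖ζ‖) ^ (q - 2) * ((1 + T) / 2 * ((A - B) * (a - b)) + (1 - T) / 2 * ((A + B) * (a + b))) := by ring
    _ ≤ _ := by gcongr

theorem translate_cont {F : Type*} [NormedAddCommGroup F] {n : ℕ} {Q : ℝ≥0∞} (hQ : 1 ≤ Q)
    (hQ' : Q ≠ ∞) {g : EuclideanSpace ℝ (Fin n) → F} (hg : MemLp g Q volume) {ε : ℝ≥0∞}
    (hε : 0 < ε) :
    ∃ δ : ℝ, 0 < δ ∧ ∀ y : EuclideanSpace ℝ (Fin n), ‖y‖ < δ →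
      eLpNorm (fun x => g (x - y) - g x) Q volume ≤ ε := by
  haveI : Fact (1 ≤ Q) := ⟨hQ⟩
  let T : C(EuclideanSpace ℝ (Fin n) × EuclideanSpace ℝ (Fin n), EuclideanSpace ℝ (Fin n)) :=
    ⟨fun p => p.2 - p.1, by fun_prop⟩
  have hT : Continuous T.curry := T.curry.continuous
  have hmp : ∀ y, MeasurePreserving (T.curry y) volume volume := fun y =>
    measurePreserving_sub_right volume y
  have hc : Continuous (fun y => Lp.compMeasurePreserving (T.curry y) (hmp y) (hg.toLp g)) :=
    Continuous.compMeasurePreservingLp continuous_const hT hmp hQ'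
  have h0 := EMetric.tendsto_nhds.1 (hc.tendsto 0) ε hε
  obtain ⟨δ, hδ, hb⟩ := Metric.eventually_nhds_iff.1 h0
  refine ⟨δ, hδ, fun y hy => ?_⟩
  have h1 := (hb (y := y) (by simpa using hy)).le
  rw [Lp.edist_def] at h1
  refine le_trans (le_of_eq (eLpNorm_congr_ae ?_)) h1
  have e1 := Lp.coeFn_compMeasurePreserving (hg.toLp g) (hmp y)
  have e2 := Lp.coeFn_compMeasurePreserving (hg.toLp g) (hmp 0)
  have e3 := hg.coeFn_toLp
  have e4 := (hmp y).quasiMeasurePreserving.ae e3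
  have e5 := (hmp 0).quasiMeasurePreserving.ae e3
  filter_upwards [e1, e2, e3, e4, e5] with x h1 h2 h3 h4 h5
  simp only [Pi.sub_apply]
  rw [h1, h2, Function.comp, Function.comp, h4, h5]
  simp [T]

theorem mollify_le {F : Type*} [NormedAddCommGroup F] [NormedSpace ℝ F] [CompleteSpace F]
    {n : ℕ} {q : ℝ} (hq : 1 ≤ q)
    {g : EuclideanSpace ℝ (Fin n) → F} (hg : MemLp g (ENNReal.ofReal q) volume) 
    (φ : ContDiffBump (0 : EuclideanSpace ℝ (Fin n))) {ε : ℝ≥0∞}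
    (hε : ∀ y : EuclideanSpace ℝ (Fin n), ‖y‖ < φ.rOut →
      eLpNorm (fun x => g (x - y) - g x) (ENNReal.ofReal q) volume ≤ ε) :
    eLpNorm (fun x => convolution (φ.normed volume) g (ContinuousLinearMap.lsmul ℝ ℝ) volume x - g x)
      (ENNReal.ofReal q) volume ≤ ε := by
  have hq0 : 0 < q := by linarith
  have hQ1 : 1 ≤ ENNReal.ofReal q := by simpa using hq
  set ρ := φ.normed volume with hρ
  have hρc : Continuous ρ := φ.continuous_normed
  have hρ0 : ∀ y, 0 ≤ ρ y := fun y => φ.nonneg_normed y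
  have hgl : LocallyIntegrable g volume := hg.locallyIntegrable hQ1
  have hex : ConvolutionExists ρ g (ContinuousLinearMap.lsmul ℝ ℝ) volume :=
    HasCompactSupport.convolutionExists_left _ φ.hasCompactSupport_normed hρc hgl
  set ν := (volume : Measure (EuclideanSpace ℝ (Fin n))).withDensity (fun y => ENNReal.ofReal (ρ y)) with hν
  have hρi : Integrable ρ volume := φ.integrable_normed
  have hρm : Measurable (fun y => ENNReal.ofReal (ρ y)) := by fun_prop
  haveI : IsProbabilityMeasure ν := ⟨by
    rw [hν, withDensity_apply _ MeasurableSet.univ, Measure.restrict_univ,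
      ← ofReal_integral_eq_lintegral_ofReal hρi (Filter.Eventually.of_forall hρ0), hρ, φ.integral_normed]
    simp⟩
  have hac : ν ≪ volume := withDensity_absolutelyContinuous _ _
  have hsm : AEStronglyMeasurable (fun a : EuclideanSpace ℝ (Fin n) × EuclideanSpace ℝ (Fin n) =>
      g (a.1 - a.2) - g a.1) (volume.prod ν) := by
    have h1 : AEStronglyMeasurable (fun a : EuclideanSpace ℝ (Fin n) × EuclideanSpace ℝ (Fin n) =>
      g (a.1 - a.2) - g a.1) (volume.prod volume) := by
      refine AEStronglyMeasurable.sub ?_ ?_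
      · exact hg.1.comp_quasiMeasurePreserving
          (quasiMeasurePreserving_sub_of_right_invariant volume volume)
      · exact hg.1.comp_quasiMeasurePreserving Measure.quasiMeasurePreserving_fst
    exact h1.mono_ac (Measure.AbsolutelyContinuous.rfl.prod hac)
  have hsm' : AEMeasurable (fun a : EuclideanSpace ℝ (Fin n) × EuclideanSpace ℝ (Fin n) =>
      ‖g (a.1 - a.2) - g a.1‖ₑ ^ q) (volume.prod ν) := hsm.enorm.pow_const _
  have hpt : ∀ x, ‖convolution ρ g (ContinuousLinearMap.lsmul ℝ ℝ) volume x - g x‖ₑ ^ q ≤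
      ∫⁻ y, ‖g (x - y) - g x‖ₑ ^ q ∂ν := by
    intro x
    have hmx : AEStronglyMeasurable (fun y => g (x - y) - g x) volume := by
      refine AEStronglyMeasurable.sub ?_ aestronglyMeasurable_const
      exact hg.1.comp_quasiMeasurePreserving (quasiMeasurePreserving_sub_left volume x)
    have e1 : convolution ρ g (ContinuousLinearMap.lsmul ℝ ℝ) volume x - g x =
        ∫ y, ρ y • (g (x - y) - g x) := by
      have i1 : Integrable (fun y => ρ y • g (x - y)) volume := hex x
      have i2 : Integrable (fun y => ρ y • g x) volume := hρi.smul_const _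
      simp_rw [smul_sub]
      rw [integral_sub i1 i2, integral_smul_const, hρ, φ.integral_normed, one_smul]
      simp [convolution_def]
    calc ‖convolution ρ g (ContinuousLinearMap.lsmul ℝ ℝ) volume x - g x‖ₑ ^ q 
        ≤ (∫⁻ y, ‖ρ y • (g (x - y) - g x)‖ₑ) ^ q := by
          gcongr
          rw [e1]; exact enorm_integral_le_lintegral_enorm _
      _ = (∫⁻ y, ‖g (x - y) - g x‖ₑ ∂ν) ^ q := by
          congr 1
          rw [hν, lintegral_withDensity_eq_lintegral_mul₀ hρm.aemeasurable hmx.enorm]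
          refine lintegral_congr fun y => ?_
          rw [enorm_smul, Pi.mul_apply, Real.enorm_of_nonneg (hρ0 y)]
      _ ≤ _ := lint_rpow_le ν hq (hmx.enorm.mono_ac hac)
  have hQ0 : ENNReal.ofReal q ≠ 0 := by simpa using hq0
  have hkey : ∫⁻ x, ‖convolution ρ g (ContinuousLinearMap.lsmul ℝ ℝ) volume x - g x‖ₑ ^ q ≤ ε ^ q := by
    calc _ ≤ ∫⁻ x, (∫⁻ y, ‖g (x - y) - g x‖ₑ ^ q ∂ν) := lintegral_mono hpt
      _ = ∫⁻ y, (∫⁻ x, ‖g (x - y) - g x‖ₑ ^ q) ∂ν := lintegral_lintegral_swap hsm'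
      _ ≤ ∫⁻ y, ε ^ q ∂ν := by
          apply lintegral_mono_ae
          have : ∀ᵐ y ∂ν, ENNReal.ofReal (ρ y) ≠ 0 := by
            rw [hν, ae_withDensity_iff hρm]
            exact Filter.Eventually.of_forall fun y h => h
          filter_upwards [this] with y hy
          have hy2 : y ∈ Function.support ρ := by
            intro h; rw [h] at hy; simp at hy
          rw [hρ, φ.support_normed_eq, mem_ball_zero_iff] at hy2
          have := hε y hy2
          rw [eLpNorm_eq_lintegral_rpow_enorm_toReal hQ0 ENNReal.ofReal_ne_top,
            ENNReal.toReal_ofReal hq0.le, one_div, ENNReal.rpow_inv_le_iff hq0] at this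
          exact this
      _ = ε ^ q := by simp
  rw [eLpNorm_eq_lintegral_rpow_enorm_toReal hQ0 ENNReal.ofReal_ne_top,
            ENNReal.toReal_ofReal hq0.le, one_div, ENNReal.rpow_inv_le_iff hq0]
  exact hkey

/-- bump functions with radii at most `δ / (k+1)` -/
noncomputable def bumpSeq (n : ℕ) (δ : ℝ) (hδ : 0 < δ) (k : ℕ) :
    ContDiffBump (0 : EuclideanSpace ℝ (Fin n)) where
  rIn := δ / (k + 1) / 2
  rOut := δ / (k + 1)
  rIn_pos := by positivity
  rIn_lt_rOut := half_lt_self (by positivity)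

theorem bumpSeq_rOut_tendsto (n : ℕ) (δ : ℝ) (hδ : 0 < δ) :
    Filter.Tendsto (fun k => (bumpSeq n δ hδ k).rOut) Filter.atTop (nhds 0) := by
  show Filter.Tendsto (fun k : ℕ => δ / ((k : ℝ) + 1)) Filter.atTop (nhds 0)
  exact tendsto_const_nhds.div_atTop
    (Filter.tendsto_atTop_add_const_right _ _ tendsto_natCast_atTop_atTop)

theorem mollify_tendsto {F : Type*} [NormedAddCommGroup F] [NormedSpace ℝ F] [CompleteSpace F]
    {n : ℕ} {q : ℝ} (hq : 1 ≤ q)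
    {g : EuclideanSpace ℝ (Fin n) → F} (hg : MemLp g (ENNReal.ofReal q) volume) (δ : ℝ) (hδ : 0 < δ) :
    Filter.Tendsto (fun k => eLpNorm (fun x => convolution ((bumpSeq n δ hδ k).normed volume) g
      (ContinuousLinearMap.lsmul ℝ ℝ) volume x - g x) (ENNReal.ofReal q) volume) Filter.atTop (nhds 0) := by
  rw [ENNReal.tendsto_nhds_zero]
  intro ε hε
  obtain ⟨δ', hδ', hb⟩ := translate_cont (by simpa using hq) ENNReal.ofReal_ne_top hg hε
  filter_upwards [(bumpSeq_rOut_tendsto n δ hδ).eventually (gt_mem_nhds hδ')] with k hk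
  exact mollify_le hq hg _ fun y hy => hb y (hy.trans hk)

theorem approx_w1 {q : ℝ} (hq : 1 ≤ q) {z : EuclideanSpace ℝ (Fin 2)} {R : ℝ} (hR : 0 < R)
    {U : EuclideanSpace ℝ (Fin 2) → ℝ} {D : EuclideanSpace ℝ (Fin 2) → EuclideanSpace ℝ (Fin 2)}
    (hU : MemLp U (ENNReal.ofReal q) volume) (hD : MemLp D (ENNReal.ofReal q) volume)
    (hweak : ∀ φ : EuclideanSpace ℝ (Fin 2) → ℝ, ContDiff ℝ 1 φ → HasCompactSupport φ →
      tsupport φ ⊆ ball z (4 * R) → ∫ x, U x • gradient φ x = -∫ x, φ x • D x) :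
    ∃ (w : ℕ → EuclideanSpace ℝ (Fin 2) → ℝ)
      (X : ℕ → EuclideanSpace ℝ (Fin 2) → EuclideanSpace ℝ (Fin 2)),
      (∀ k, ContDiff ℝ 1 (w k)) ∧ (∀ k, ∀ x ∈ ball z (3 * R), gradient (w k) x = X k x) ∧
      (∀ k, AEStronglyMeasurable (X k) volume) ∧
      Filter.Tendsto (fun k => eLpNorm (fun x => w k x - U x) (ENNReal.ofReal q) volume)
        Filter.atTop (nhds 0) ∧
      Filter.Tendsto (fun k => eLpNorm (fun x => X k x - D x) (ENNReal.ofReal q) volume)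
        Filter.atTop (nhds 0) := by
  have hQ1 : 1 ≤ ENNReal.ofReal q := by simpa using hq
  have hUl := hU.locallyIntegrable hQ1
  have hDl := hD.locallyIntegrable hQ1
  have hR2 : 0 < R / 2 := by positivity
  set ρ := fun k => (bumpSeq 2 (R / 2) hR2 k).normed volume with hρ
  have hρd : ∀ k, ContDiff ℝ 1 (ρ k) := fun k => (bumpSeq 2 (R / 2) hR2 k).contDiff_normed (n := 1)
  have hρc : ∀ k, HasCompactSupport (ρ k) := fun k => (bumpSeq 2 (R / 2) hR2 k).hasCompactSupport_normed
  refine ⟨fun k => convolution (ρ k) U (ContinuousLinearMap.lsmul ℝ ℝ) volume,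
    fun k => convolution (ρ k) D (ContinuousLinearMap.lsmul ℝ ℝ) volume, fun k => ?_, fun k x hx => ?_,
    fun k => ?_, mollify_tendsto hq hU _ hR2, mollify_tendsto hq hD _ hR2⟩
  · exact (hρc k).contDiff_convolution_left _ (hρd k) hUl
  · have hfd := (hρc k).hasFDerivAt_convolution_left (ContinuousLinearMap.lsmul ℝ ℝ) (hρd k) hUl x
    set φ : EuclideanSpace ℝ (Fin 2) → ℝ := fun y => ρ k (x - y) with hφ
    have hφd : ContDiff ℝ 1 φ := (hρd k).comp (contDiff_const.sub contDiff_id)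
    have hφc : HasCompactSupport φ := (hρc k).comp_homeomorph (Homeomorph.subLeft x)
    have hrad : (bumpSeq 2 (R / 2) hR2 k).rOut ≤ R / 2 := by
      show R / 2 / ((k : ℝ) + 1) ≤ R / 2
      apply div_le_self hR2.le
      have : (0 : ℝ) ≤ k := Nat.cast_nonneg k
      linarith
    have hsupp : tsupport φ ⊆ ball z (4 * R) := by
      have h1 : tsupport φ ⊆ closedBall x (R / 2) := by
        refine closure_minimal ?_ isClosed_closedBall
        intro y hy
        have hy : x - y ∈ Function.support (ρ k) := hy
        rw [hρ, ContDiffBump.support_normed_eq, mem_ball_zero_iff] at hy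
        rw [mem_closedBall, dist_eq_norm, norm_sub_rev]
        linarith
      refine h1.trans fun y hy => ?_
      rw [mem_closedBall] at hy
      rw [mem_ball] at hx ⊢
      have := dist_triangle y x z
      linarith
    have hw := hweak φ hφd hφc hsupp
    apply ext_inner_right ℝ
    intro v
    rw [inner_gradient_left, hfd.fderiv]
    have hgr : ∀ y, gradient φ y = - gradient (ρ k) (x - y) := by
      intro y
      apply ext_inner_right ℝ
      intro v
      rw [inner_gradient_left, inner_neg_left, inner_gradient_left]
      have h1 : HasFDerivAt (fun y : EuclideanSpace ℝ (Fin 2) => x - y)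
          (-(ContinuousLinearMap.id ℝ (EuclideanSpace ℝ (Fin 2)))) y := (hasFDerivAt_id y).const_sub x
      have h2 : HasFDerivAt (ρ k) (fderiv ℝ (ρ k) (x - y)) (x - y) :=
        ((hρd k).differentiable (by norm_num) (x - y)).hasFDerivAt
      have h3 : HasFDerivAt φ _ y := h2.comp y h1
      rw [h3.fderiv]
      simp
    have hrhs : convolution (ρ k) D (ContinuousLinearMap.lsmul ℝ ℝ) volume x = ∫ y, φ y • D y := by
      rw [convolution_eq_swap]; simp [hφ]
    have hlhs : (∫ y, U y • gradient (ρ k) (x - y)) = ∫ y, φ y • D y := by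
      have : (∫ y, U y • gradient φ y) = - ∫ y, U y • gradient (ρ k) (x - y) := by
        rw [← integral_neg]
        refine integral_congr_ae (Filter.Eventually.of_forall fun y => ?_)
        simp [hgr]
      rw [this] at hw
      exact neg_injective hw
    show _ = ⟪convolution (ρ k) D (ContinuousLinearMap.lsmul ℝ ℝ) volume x, v⟫
    rw [hrhs, ← hlhs]
    have hgc : Continuous (gradient (ρ k)) := by
      have := (hρd k).continuous_fderiv (by norm_num)
      unfold gradient
      exact (LinearIsometryEquiv.continuous _).comp this
    have hgcs : HasCompactSupport (gradient (ρ k)) := by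
      have := (hρc k).fderiv ℝ
      exact this.comp_left (g := (InnerProductSpace.toDual ℝ (EuclideanSpace ℝ (Fin 2))).symm) (map_zero _)
    have hi : Integrable (fun y => U y • gradient (ρ k) (x - y)) volume := by
      apply hUl.integrable_smul_right_of_hasCompactSupport
      · exact hgc.comp (by fun_prop)
      · exact hgcs.comp_homeomorph (Homeomorph.subLeft x)
    rw [real_inner_comm, ← integral_inner hi]
    have hex := ((hρc k).fderiv ℝ).convolutionExists_left (L := (ContinuousLinearMap.lsmul ℝ ℝ).precompL
      (EuclideanSpace ℝ (Fin 2))) (μ := volume) ((hρd k).continuous_fderiv (by norm_num)) hUl x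
    rw [convolution_eq_swap]
    have hi2 := hex.integrable_swap
    rw [ContinuousLinearMap.integral_apply hi2]
    refine integral_congr_ae (Filter.Eventually.of_forall fun y => ?_)
    simp only [ContinuousLinearMap.precompL_apply, ContinuousLinearMap.lsmul_apply]
    rw [real_inner_smul_right, real_inner_comm, inner_gradient_left, smul_eq_mul, mul_comm]
  · exact ((hρc k).contDiff_convolution_left (n := 0) _ (hρd k |>.of_le (by norm_num)) hDl).continuous.aestronglyMeasurable

theorem norm_gradient_eq {n : ℕ} (w : EuclideanSpace ℝ (Fin n) → ℝ) (x : EuclideanSpace ℝ (Fin n)) :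
    ‖gradient w x‖ = ‖fderiv ℝ w x‖ := by
  unfold gradient; simp

theorem continuous_gradient {n : ℕ} {w : EuclideanSpace ℝ (Fin n) → ℝ} (hw : ContDiff ℝ 1 w) :
    Continuous (gradient w) := by
  have := hw.continuous_fderiv (by norm_num)
  unfold gradient
  exact (LinearIsometryEquiv.continuous _).comp this

theorem lint_ball_translate_le {z v : EuclideanSpace ℝ (Fin 2)} {R : ℝ} (hv : ‖v‖ ≤ R)
    (φ : EuclideanSpace ℝ (Fin 2) → ℝ≥0∞) :
    ∫⁻ x in ball z (2 * R), φ (x + v) ≤ ∫⁻ x in ball z (3 * R), φ x := by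
  rw [← lintegral_indicator measurableSet_ball, ← lintegral_indicator measurableSet_ball,
    ← lintegral_add_right_eq_self (fun x => (ball z (3 * R)).indicator φ x) v]
  refine lintegral_mono fun x => ?_
  by_cases hx : x ∈ ball z (2 * R)
  · rw [Set.indicator_of_mem hx, Set.indicator_of_mem]
    rw [mem_ball, dist_eq_norm] at hx ⊢
    have : x + v - z = (x - z) + v := by abel
    rw [this]
    have := norm_add_le (x - z) v
    linarith
  · rw [Set.indicator_of_notMem hx]; exact zero_le

theorem dq_smooth {q : ℝ} (hq : 1 ≤ q) {z e : EuclideanSpace ℝ (Fin 2)} {R h : ℝ} (he : ‖e‖ = 1)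
    (hh : |h| < R) {w : EuclideanSpace ℝ (Fin 2) → ℝ} (hw : ContDiff ℝ 1 w) :
    ∫⁻ x in ball z (2 * R), ‖w (x + h • e) - w x‖ₑ ^ q ≤
      ‖h‖ₑ ^ q * ∫⁻ x in ball z (3 * R), ‖gradient w x‖ₑ ^ q := by
  have hq0 : 0 < q := by linarith
  have hgc := continuous_gradient hw
  let ν : Measure ℝ := volume.restrict (Set.Ioc 0 1)
  have : IsProbabilityMeasure ν := ⟨by simp [ν]⟩
  have hpt : ∀ x, ‖w (x + h • e) - w x‖ₑ ^ q ≤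
      ∫⁻ t, ‖h‖ₑ ^ q * ‖gradient w (x + t • h • e)‖ₑ ^ q ∂ν := by
    intro x
    have hd : ∀ t : ℝ, HasDerivAt (fun t : ℝ => w (x + t • h • e))
        (fderiv ℝ w (x + t • h • e) (h • e)) t := by
      intro t
      have h1 : HasDerivAt (fun t : ℝ => x + t • h • e) (h • e) t := by
        simpa using ((hasDerivAt_id t).smul_const (h • e)).const_add x
      exact ((hw.differentiable (by norm_num) (x + t • h • e)).hasFDerivAt).comp_hasDerivAt t h1
    have hc : Continuous (fun t : ℝ => fderiv ℝ w (x + t • h • e) (h • e)) :=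
      ((hw.continuous_fderiv (by norm_num)).comp (by fun_prop)).clm_apply continuous_const
    have hftc := intervalIntegral.integral_eq_sub_of_hasDerivAt (a := 0) (b := 1)
      (fun t _ => hd t) (hc.intervalIntegrable _ _)
    simp only [one_smul, zero_smul, add_zero] at hftc
    rw [intervalIntegral.integral_of_le zero_le_one] at hftc
    rw [← hftc]
    calc _ ≤ (∫⁻ t, ‖fderiv ℝ w (x + t • h • e) (h • e)‖ₑ ∂ν) ^ q := by
          gcongr
          exact enorm_integral_le_lintegral_enorm _
      _ ≤ ∫⁻ t, ‖fderiv ℝ w (x + t • h • e) (h • e)‖ₑ ^ q ∂ν :=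
          lint_rpow_le ν hq hc.aestronglyMeasurable.enorm
      _ ≤ _ := by
          refine lintegral_mono fun t => ?_
          rw [← ENNReal.mul_rpow_of_nonneg _ _ hq0.le]
          gcongr
          rw [← ofReal_norm, ← ofReal_norm, ← ofReal_norm, ← ENNReal.ofReal_mul (norm_nonneg _)]
          apply ENNReal.ofReal_le_ofReal
          rw [norm_gradient_eq]
          refine (ContinuousLinearMap.le_opNorm _ _).trans (le_of_eq ?_)
          rw [norm_smul, he, mul_one, mul_comm]
  have hm : Measurable (fun a : EuclideanSpace ℝ (Fin 2) × ℝ =>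
      ‖h‖ₑ ^ q * ‖gradient w (a.1 + a.2 • h • e)‖ₑ ^ q) := by
    have : Continuous (fun a : EuclideanSpace ℝ (Fin 2) × ℝ => gradient w (a.1 + a.2 • h • e)) :=
      hgc.comp (by fun_prop)
    exact (this.measurable.enorm.pow_const _).const_mul _
  calc _ ≤ ∫⁻ x in ball z (2 * R), (∫⁻ t, ‖h‖ₑ ^ q * ‖gradient w (x + t • h • e)‖ₑ ^ q ∂ν) :=
        lintegral_mono fun x => hpt x
    _ = ∫⁻ t, (∫⁻ x in ball z (2 * R), ‖h‖ₑ ^ q * ‖gradient w (x + t • h • e)‖ₑ ^ q) ∂ν :=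
        lintegral_lintegral_swap hm.aemeasurable
    _ ≤ ∫⁻ t, (‖h‖ₑ ^ q * ∫⁻ x in ball z (3 * R), ‖gradient w x‖ₑ ^ q) ∂ν := by
        apply lintegral_mono_ae
        have : ∀ᵐ t ∂ν, t ∈ Set.Ioc (0 : ℝ) 1 := ae_restrict_mem measurableSet_Ioc
        filter_upwards [this] with t ht
        rw [lintegral_const_mul' _ _ (by finiteness)]
        refine mul_le_mul' le_rfl ?_
        apply lint_ball_translate_le (v := t • h • e) (φ := fun x => ‖gradient w x‖ₑ ^ q)
        rw [norm_smul, norm_smul, he, mul_one, Real.norm_eq_abs, abs_of_pos ht.1, Real.norm_eq_abs]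
        nlinarith [ht.2, abs_nonneg h]
    _ = _ := by simp

theorem lint_eq_eLpNorm {F : Type*} [NormedAddCommGroup F] {α : Type*} [MeasurableSpace α]
    (μ : Measure α) {q : ℝ} (hq : 0 < q) (g : α → F) :
    ∫⁻ x, ‖g x‖ₑ ^ q ∂μ = (eLpNorm g (ENNReal.ofReal q) μ) ^ q := by
  rw [eLpNorm_eq_lintegral_rpow_enorm_toReal (by simpa using hq) ENNReal.ofReal_ne_top,
            ENNReal.toReal_ofReal hq.le, one_div, ENNReal.rpow_inv_rpow hq.ne']

set_option maxHeartbeats 800000 in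
theorem dq_limit {q : ℝ} (hq : 1 ≤ q) {z e : EuclideanSpace ℝ (Fin 2)} {R h : ℝ} (he : ‖e‖ = 1)
    (hh : |h| < R) 
    {U : EuclideanSpace ℝ (Fin 2) → ℝ} {D : EuclideanSpace ℝ (Fin 2) → EuclideanSpace ℝ (Fin 2)}
    (hU : MemLp U (ENNReal.ofReal q) volume) (hD : MemLp D (ENNReal.ofReal q) volume)
    {w : ℕ → EuclideanSpace ℝ (Fin 2) → ℝ}
    {X : ℕ → EuclideanSpace ℝ (Fin 2) → EuclideanSpace ℝ (Fin 2)}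
    (hw : ∀ k, ContDiff ℝ 1 (w k)) (hX : ∀ k, ∀ x ∈ ball z (3 * R), gradient (w k) x = X k x)
    (hXm : ∀ k, AEStronglyMeasurable (X k) volume) 
    (hwl : Filter.Tendsto (fun k => eLpNorm (fun x => w k x - U x) (ENNReal.ofReal q) volume)
        Filter.atTop (nhds 0))
    (hXl : Filter.Tendsto (fun k => eLpNorm (fun x => X k x - D x) (ENNReal.ofReal q) volume)
        Filter.atTop (nhds 0)) :
    ∫⁻ x in ball z (2 * R), ‖U (x + h • e) - U x‖ₑ ^ q ≤
      ‖h‖ₑ ^ q * ∫⁻ x, ‖D x‖ₑ ^ q := by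
  have hq0 : 0 < q := by linarith
  have hQ1 : 1 ≤ ENNReal.ofReal q := by simpa using hq
  set Q := ENNReal.ofReal q with hQ
  set B : Measure (EuclideanSpace ℝ (Fin 2)) := volume.restrict (ball z (2 * R)) with hB
  set B3 : Measure (EuclideanSpace ℝ (Fin 2)) := volume.restrict (ball z (3 * R)) with hB3
  rw [lint_eq_eLpNorm _ hq0, lint_eq_eLpNorm _ hq0, ← ENNReal.mul_rpow_of_nonneg _ _ hq0.le]
  gcongr
  have hmp : MeasurePreserving (fun x : EuclideanSpace ℝ (Fin 2) => x + h • e) volume volume :=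
    measurePreserving_add_right volume _
  have hk : ∀ k, eLpNorm (fun x => U (x + h • e) - U x) Q B ≤
      eLpNorm (fun x => w k x - U x) Q volume + eLpNorm (fun x => w k x - U x) Q volume +
      ‖h‖ₑ * (eLpNorm (fun x => X k x - D x) Q volume + eLpNorm D Q volume) := by
    intro k
    have hwm : AEStronglyMeasurable (w k) volume := (hw k).continuous.aestronglyMeasurable
    have m1 : AEStronglyMeasurable (fun x => w k x - U x) volume := hwm.sub hU.1
    have m2 : AEStronglyMeasurable (fun x => w k (x + h • e) - U (x + h • e)) volume :=
      m1.comp_measurePreserving hmp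
    have m3 : AEStronglyMeasurable (fun x => w k (x + h • e) - w k x) volume := 
      (hwm.comp_measurePreserving hmp).sub hwm
    have e1 : (fun x => U (x + h • e) - U x) =
        ((fun x => w k x - U x) - (fun x => w k (x + h • e) - U (x + h • e))) +
          fun x => w k (x + h • e) - w k x := by
      funext x; simp only [Pi.add_apply, Pi.sub_apply]; ring
    rw [e1]
    refine (eLpNorm_add_le (m1.sub m2).restrict m3.restrict hQ1).trans ?_
    refine add_le_add ((eLpNorm_sub_le m1.restrict m2.restrict hQ1).trans (add_le_add ?_ ?_)) ?_
    · exact eLpNorm_mono_measure _ Measure.restrict_le_self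
    · refine (eLpNorm_mono_measure _ Measure.restrict_le_self).trans (le_of_eq ?_)
      have := eLpNorm_comp_measurePreserving (p := Q) m1 hmp
      exact this
    · have h1 := dq_smooth hq (z := z) he hh (hw k)
      rw [lint_eq_eLpNorm _ hq0, lint_eq_eLpNorm _ hq0, ← ENNReal.mul_rpow_of_nonneg _ _ hq0.le,
        ENNReal.rpow_le_rpow_iff hq0] at h1
      refine h1.trans ?_
      gcongr
      have e2 : eLpNorm (gradient (w k)) Q B3 = eLpNorm ((fun x => X k x - D x) + D) Q B3 := by
        apply eLpNorm_congr_ae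
        filter_upwards [ae_restrict_mem measurableSet_ball] with x hx
        simp [hX k x hx]
      rw [← hQ, e2]
      refine (eLpNorm_mono_measure _ Measure.restrict_le_self).trans ?_
      exact eLpNorm_add_le ((hXm k).sub hD.1) hD.1 hQ1
  have hlim := (hwl.add hwl).add (ENNReal.Tendsto.const_mul (a := ‖h‖ₑ) (hXl.add_const (eLpNorm D Q volume))
    (Or.inr (by finiteness)))
  simp only [add_zero, zero_add] at hlim
  exact ge_of_tendsto hlim (Filter.Eventually.of_forall hk)

theorem inner_real_mul (a b : ℝ) : ⟪a, b⟫ = a * b := by simp [mul_comm]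

theorem pair_integrable {F : Type*} [NormedAddCommGroup F] [InnerProductSpace ℝ F] {α : Type*}
    [MeasurableSpace α] {μ : Measure α} {p q : ℝ} (hpq : p.HolderConjugate q)
    {Ψ Y : α → F} (hΨ : MemLp Ψ (ENNReal.ofReal p) μ) (hY : MemLp Y (ENNReal.ofReal q) μ) :
    Integrable (fun x => ⟪Ψ x, Y x⟫) μ := by
  have : ENNReal.HolderConjugate (ENNReal.ofReal p) (ENNReal.ofReal q) := hpq.ennrealOfReal
  have h := MemLp.integrable_mul hΨ.norm hY.norm
  refine h.mono (hΨ.1.inner hY.1) (Filter.Eventually.of_forall fun x => ?_)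
  simp only [Pi.mul_apply, norm_mul, norm_norm]
  exact norm_inner_le_norm _ _

theorem pair_le {F : Type*} [NormedAddCommGroup F] [InnerProductSpace ℝ F] {α : Type*}
    [MeasurableSpace α] {μ : Measure α} {p q : ℝ} (hpq : p.HolderConjugate q)
    {Ψ Y : α → F} (hΨ : AEStronglyMeasurable Ψ μ) (hY : AEStronglyMeasurable Y μ) :
    ‖∫ x, ⟪Ψ x, Y x⟫ ∂μ‖ₑ ≤ eLpNorm Ψ (ENNReal.ofReal p) μ * eLpNorm Y (ENNReal.ofReal q) μ := by
  refine (enorm_integral_le_lintegral_enorm _).trans ?_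
  have h := ENNReal.lintegral_mul_le_Lp_mul_Lq μ hpq hΨ.enorm hY.enorm
  rw [lint_eq_eLpNorm _ hpq.pos, lint_eq_eLpNorm _ hpq.symm.pos, one_div, one_div,
    ENNReal.rpow_rpow_inv hpq.pos.ne', ENNReal.rpow_rpow_inv hpq.symm.pos.ne'] at h
  refine le_trans (lintegral_mono fun x => ?_) h
  simp only [Pi.mul_apply]
  rw [← ofReal_norm, ← ofReal_norm, ← ofReal_norm, ← ENNReal.ofReal_mul (norm_nonneg _)]
  exact ENNReal.ofReal_le_ofReal (norm_inner_le_norm _ _)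

theorem pair_tendsto {F : Type*} [NormedAddCommGroup F] [InnerProductSpace ℝ F] {α : Type*}
    [MeasurableSpace α] {μ : Measure α} {p q : ℝ} (hpq : p.HolderConjugate q)
    {Ψ Y : α → F} {Z : ℕ → α → F} (hΨ : MemLp Ψ (ENNReal.ofReal p) μ)
    (hY : MemLp Y (ENNReal.ofReal q) μ) (hZ : ∀ᶠ k in Filter.atTop, MemLp (Z k) (ENNReal.ofReal q) μ)
    (hl : Filter.Tendsto (fun k => eLpNorm (fun x => Z k x - Y x) (ENNReal.ofReal q) μ)
      Filter.atTop (nhds 0)) :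
    Filter.Tendsto (fun k => ∫ x, ⟪Ψ x, Z k x⟫ ∂μ) Filter.atTop (nhds (∫ x, ⟪Ψ x, Y x⟫ ∂μ)) := by
  rw [tendsto_iff_edist_tendsto_0]
  have h0 : Filter.Tendsto (fun k => eLpNorm Ψ (ENNReal.ofReal p) μ *
      eLpNorm (fun x => Z k x - Y x) (ENNReal.ofReal q) μ) Filter.atTop (nhds 0) := by
    have := ENNReal.Tendsto.const_mul (a := eLpNorm Ψ (ENNReal.ofReal p) μ) hl (Or.inr hΨ.2.ne)
    simpa using this
  refine tendsto_of_tendsto_of_tendsto_of_le_of_le' tendsto_const_nhds h0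
    (Filter.Eventually.of_forall fun k => zero_le) ?_
  filter_upwards [hZ] with k hk
  rw [edist_eq_enorm_sub, ← integral_sub (pair_integrable hpq hΨ hk) (pair_integrable hpq hΨ hY)]
  simp_rw [← inner_sub_right]
  exact pair_le hpq hΨ.1 (hk.1.sub hY.1)

theorem gradient_sub_translate {ψ : EuclideanSpace ℝ (Fin 2) → ℝ} (hψ : ContDiff ℝ 1 ψ)
    (v x : EuclideanSpace ℝ (Fin 2)) :
    gradient (fun x => ψ (x - v) - ψ x) x = gradient ψ (x - v) - gradient ψ x := by
  apply ext_inner_right ℝ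
  intro e
  rw [inner_sub_left, inner_gradient_left, inner_gradient_left, inner_gradient_left]
  have hd := hψ.differentiable (by norm_num)
  have h1 : HasFDerivAt (fun x => ψ (x - v)) (fderiv ℝ ψ (x - v)) x := by
    have := (hd (x - v)).hasFDerivAt.comp x ((hasFDerivAt_id x).sub_const v)
    simpa [Function.comp_def] using this
  have h2 : HasFDerivAt (fun x => ψ (x - v) - ψ x) _ x := h1.sub (hd x).hasFDerivAt
  rw [h2.fderiv]
  rfl

theorem memLp_gradient {ψ : EuclideanSpace ℝ (Fin 2) → ℝ} (hψ : ContDiff ℝ 1 ψ) 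
    (hc : HasCompactSupport ψ) (Q : ℝ≥0∞) : MemLp (gradient ψ) Q volume := by
  have hgcs : HasCompactSupport (gradient ψ) := by
    have := hc.fderiv ℝ
    exact this.comp_left (g := (InnerProductSpace.toDual ℝ (EuclideanSpace ℝ (Fin 2))).symm) (map_zero _)
  exact (continuous_gradient hψ).memLp_of_hasCompactSupport hgcs

theorem shift_test {p q : ℝ} (hpq : p.HolderConjugate q) {z v : EuclideanSpace ℝ (Fin 2)} {R : ℝ}
    (hR : 0 < R) (hv : ‖v‖ < R)
    {A : EuclideanSpace ℝ (Fin 2) → EuclideanSpace ℝ (Fin 2)} {F : EuclideanSpace ℝ (Fin 2) → ℝ}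
    (hA : MemLp A (ENNReal.ofReal p) volume) (hF : MemLp F (ENNReal.ofReal p) volume)
    (hsol : ∀ φ : EuclideanSpace ℝ (Fin 2) → ℝ, ContDiff ℝ 1 φ → HasCompactSupport φ →
      tsupport φ ⊆ ball z (4 * R) → ∫ x, ⟪A x, gradient φ x⟫ = ∫ x, F x * φ x)
    {ψ : EuclideanSpace ℝ (Fin 2) → ℝ} (hψ : ContDiff ℝ 1 ψ) (hs : tsupport ψ ⊆ closedBall z R) :
    ∫ x, ⟪A (x + v) - A x, gradient ψ x⟫ = ∫ x, (F (x + v) - F x) * ψ x := by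
  have hc : HasCompactSupport ψ :=
    HasCompactSupport.of_support_subset_isCompact (isCompact_closedBall z R)
      ((subset_tsupport ψ).trans hs)
  have hmp : MeasurePreserving (fun x : EuclideanSpace ℝ (Fin 2) => x + v) volume volume :=
    measurePreserving_add_right volume _
  have hmp' : MeasurePreserving (fun x : EuclideanSpace ℝ (Fin 2) => x - v) volume volume :=
    measurePreserving_sub_right volume _
  have hsub : Function.support (fun x => ψ (x - v) - ψ x) ⊆ closedBall z (2 * R) := by
    intro x hx
    by_contra hxx
    rw [mem_closedBall, dist_eq_norm, not_le] at hxx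
    apply hx
    have h1 : ψ x = 0 := by
      by_contra h
      have := hs (subset_tsupport ψ h)
      rw [mem_closedBall, dist_eq_norm] at this
      linarith
    have h2 : ψ (x - v) = 0 := by
      by_contra h
      have := hs (subset_tsupport ψ h)
      rw [mem_closedBall, dist_eq_norm] at this
      have h3 := norm_add_le (x - v - z) v
      have h4 : x - v - z + v = x - z := by abel
      rw [h4] at h3
      linarith
    show ψ (x - v) - ψ x = 0
    rw [h1, h2, sub_zero]
  have hφd : ContDiff ℝ 1 (fun x => ψ (x - v) - ψ x) :=
    (hψ.comp (contDiff_id.sub contDiff_const)).sub hψ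
  have key := hsol (fun x => ψ (x - v) - ψ x) hφd
    (HasCompactSupport.of_support_subset_isCompact (isCompact_closedBall z (2 * R)) hsub)
    ((closure_minimal hsub isClosed_closedBall).trans (closedBall_subset_ball (by linarith)))
  simp_rw [gradient_sub_translate hψ v] at key
  have hG : MemLp (gradient ψ) (ENNReal.ofReal q) volume := memLp_gradient hψ hc _
  have hψm : MemLp ψ (ENNReal.ofReal q) volume := hψ.continuous.memLp_of_hasCompactSupport hc
  have hAv : MemLp (fun x => A (x + v)) (ENNReal.ofReal p) volume := hA.comp_measurePreserving hmp
  have hFv : MemLp (fun x => F (x + v)) (ENNReal.ofReal p) volume := hF.comp_measurePreserving hmp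
  have hGv : MemLp (fun x => gradient ψ (x - v)) (ENNReal.ofReal q) volume :=
    hG.comp_measurePreserving hmp'
  have hψv : MemLp (fun x => ψ (x - v)) (ENNReal.ofReal q) volume :=
    hψm.comp_measurePreserving hmp'
  have mulint : ∀ {a b : EuclideanSpace ℝ (Fin 2) → ℝ}, MemLp a (ENNReal.ofReal p) volume →
      MemLp b (ENNReal.ofReal q) volume → Integrable (fun x => a x * b x) volume := by
    intro a b ha hb
    have := pair_integrable hpq ha hb
    simpa [mul_comm] using this
  simp_rw [inner_sub_right, mul_sub] at key
  rw [integral_sub (pair_integrable hpq hA hGv) (pair_integrable hpq hA hG),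
    integral_sub (mulint hF hψv) (mulint hF hψm)] at key
  simp_rw [inner_sub_left, sub_mul]
  rw [integral_sub (pair_integrable hpq hAv hG) (pair_integrable hpq hA hG),
    integral_sub (mulint hFv hψm) (mulint hF hψm)]
  have t1 := integral_add_right_eq_self (μ := volume) (fun x => ⟪A x, gradient ψ (x - v)⟫) v
  have t2 := integral_add_right_eq_self (μ := volume) (fun x => F x * ψ (x - v)) v
  simp only [add_sub_cancel_right] at t1 t2
  rw [t1, t2]
  exact key

theorem gradient_cutoff {η w : EuclideanSpace ℝ (Fin 2) → ℝ} (hη : ContDiff ℝ 1 η)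
    (hw : ContDiff ℝ 1 w) (v x : EuclideanSpace ℝ (Fin 2)) :
    gradient (fun x => η x ^ 2 * (w (x + v) - w x)) x =
      (η x ^ 2) • (gradient w (x + v) - gradient w x) +
        (2 * η x * (w (x + v) - w x)) • gradient η x := by
  apply ext_inner_right ℝ
  intro e
  rw [inner_add_left, real_inner_smul_left, real_inner_smul_left, inner_sub_left,
    inner_gradient_left, inner_gradient_left, inner_gradient_left, inner_gradient_left]
  have hd := hw.differentiable (by norm_num)
  have h1 : HasFDerivAt (fun x => w (x + v)) (fderiv ℝ w (x + v)) x := by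
    have := (hd (x + v)).hasFDerivAt.comp x ((hasFDerivAt_id x).add_const v)
    simpa [Function.comp_def] using this
  have h2 := ((hη.differentiable (by norm_num) x).hasFDerivAt.pow 2).mul (h1.sub (hd x).hasFDerivAt)
  have h3 : HasFDerivAt (fun x => η x ^ 2 * (w (x + v) - w x)) _ x := h2
  rw [h3.fderiv]
  simp
  ring

theorem memLp_bdd_smul {F : Type*} [NormedAddCommGroup F] [NormedSpace ℝ F]
    {Q : ℝ≥0∞} {c : EuclideanSpace ℝ (Fin 2) → ℝ} {g : EuclideanSpace ℝ (Fin 2) → F} (hc : Continuous c)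
    (hcs : HasCompactSupport c) (hg : MemLp g Q volume) : MemLp (fun x => c x • g x) Q volume := by
  have hct : MemLp c ∞ volume := hc.memLp_of_hasCompactSupport hcs
  have := hg.smul (p := ∞) (r := Q) hct
  exact this

theorem memLp_psi2 {P : ℝ≥0∞} {η : EuclideanSpace ℝ (Fin 2) → ℝ} (hη : ContDiff ℝ 1 η)
    (hηc : HasCompactSupport η) {T : EuclideanSpace ℝ (Fin 2) → EuclideanSpace ℝ (Fin 2)}
    (hτA : MemLp T P volume) : MemLp (fun x => 2 * η x * ⟪T x, gradient η x⟫) P volume := by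
  obtain ⟨C, hC⟩ := (continuous_gradient hη).bounded_above_of_compact_support (by
    have := hηc.fderiv ℝ
    exact this.comp_left (g := (InnerProductSpace.toDual ℝ (EuclideanSpace ℝ (Fin 2))).symm) (map_zero _))
  have h3 : MemLp (fun x => ⟪T x, gradient η x⟫) P volume := by
    refine MemLp.of_le_mul (c := C) hτA (hτA.1.inner (continuous_gradient hη).aestronglyMeasurable)
      (Filter.Eventually.of_forall fun x => ?_)
    refine (norm_inner_le_norm _ _).trans ?_
    rw [mul_comm]
    exact mul_le_mul_of_nonneg_right (hC x) (norm_nonneg _)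
  have h4 := memLp_bdd_smul (c := fun x => 2 * η x) (continuous_const.mul hη.continuous)
    (hηc.comp_left (g := fun t : ℝ => 2 * t) (by simp)) h3
  simpa using h4

theorem weak_id_smooth {p q : ℝ} (hpq : p.HolderConjugate q) {z v : EuclideanSpace ℝ (Fin 2)} {R : ℝ}
    (hR : 0 < R) (hv : ‖v‖ < R)
    {A : EuclideanSpace ℝ (Fin 2) → EuclideanSpace ℝ (Fin 2)} {F : EuclideanSpace ℝ (Fin 2) → ℝ}
    (hA : MemLp A (ENNReal.ofReal p) volume) (hF : MemLp F (ENNReal.ofReal p) volume)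
    (hsol : ∀ φ : EuclideanSpace ℝ (Fin 2) → ℝ, ContDiff ℝ 1 φ → HasCompactSupport φ →
      tsupport φ ⊆ ball z (4 * R) → ∫ x, ⟪A x, gradient φ x⟫ = ∫ x, F x * φ x)
    {η w : EuclideanSpace ℝ (Fin 2) → ℝ} (hη : ContDiff ℝ 1 η) (hηs : tsupport η ⊆ closedBall z R)
    (hw : ContDiff ℝ 1 w) {X : EuclideanSpace ℝ (Fin 2) → EuclideanSpace ℝ (Fin 2)}
    (hX : ∀ x ∈ ball z (3 * R), gradient w x = X x)
    (hwm : MemLp w (ENNReal.ofReal q) volume) (hXm : MemLp X (ENNReal.ofReal q) volume) :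
    (∫ x, ⟪(η x ^ 2) • (A (x + v) - A x), X (x + v) - X x⟫) +
      (∫ x, ⟪2 * η x * ⟪A (x + v) - A x, gradient η x⟫, w (x + v) - w x⟫) =
    ∫ x, ⟪η x ^ 2 • (F (x + v) - F x), w (x + v) - w x⟫ := by
  have hmp : MeasurePreserving (fun x : EuclideanSpace ℝ (Fin 2) => x + v) volume volume :=
    measurePreserving_add_right volume _
  have hηc : HasCompactSupport η :=
    HasCompactSupport.of_support_subset_isCompact (isCompact_closedBall z R)
      ((subset_tsupport η).trans hηs)
  have hτA : MemLp (fun x => A (x + v) - A x) (ENNReal.ofReal p) volume :=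
    (hA.comp_measurePreserving hmp).sub hA
  have hτX : MemLp (fun x => X (x + v) - X x) (ENNReal.ofReal q) volume :=
    (hXm.comp_measurePreserving hmp).sub hXm
  have hτw : MemLp (fun x => w (x + v) - w x) (ENNReal.ofReal q) volume :=
    (hwm.comp_measurePreserving hmp).sub hwm
  have hη2c : HasCompactSupport (fun x => η x ^ 2) := hηc.comp_left (g := fun t : ℝ => t ^ 2) (by simp)
  have h1 : MemLp (fun x => (η x ^ 2) • (A (x + v) - A x)) (ENNReal.ofReal p) volume :=
    memLp_bdd_smul (hη.continuous.pow 2) hη2c hτA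
  have h2 : MemLp (fun x => 2 * η x * ⟪A (x + v) - A x, gradient η x⟫) (ENNReal.ofReal p) volume := by
    exact memLp_psi2 hη hηc hτA
  rw [← integral_add (pair_integrable hpq h1 hτX) (pair_integrable hpq h2 hτw)]
  have hψ : ContDiff ℝ 1 (fun x => η x ^ 2 * (w (x + v) - w x)) :=
    (hη.pow 2).mul ((hw.comp (contDiff_id.add contDiff_const)).sub hw)
  have hsub : tsupport (fun x => η x ^ 2 * (w (x + v) - w x)) ⊆ closedBall z R := by
    refine (closure_mono ?_).trans hηs
    intro x hx hx0
    apply hx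
    simp [show η x = 0 from hx0]
  have key := shift_test hpq hR hv hA hF hsol hψ hsub
  calc _ = ∫ x, ⟪A (x + v) - A x, gradient (fun x => η x ^ 2 * (w (x + v) - w x)) x⟫ := by
        refine integral_congr_ae (Filter.Eventually.of_forall fun x => ?_)
        simp only
        rw [gradient_cutoff hη hw, inner_add_right, real_inner_smul_right, real_inner_smul_left,
          real_inner_smul_right]
        congr 1
        · by_cases hx : η x = 0
          · simp [hx]
          · have hx' := hηs (subset_tsupport η hx)
            rw [mem_closedBall, dist_eq_norm] at hx'
            rw [hX x (by rw [mem_ball, dist_eq_norm]; linarith), hX (x + v)]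
            rw [mem_ball, dist_eq_norm]
            have h3 := norm_add_le (x - z) v
            have h4 : x - z + v = x + v - z := by abel
            rw [h4] at h3
            linarith
        · simp [mul_comm, mul_left_comm]; ring
    _ = _ := key
    _ = _ := by
        refine integral_congr_ae (Filter.Eventually.of_forall fun x => ?_)
        simp [mul_comm, mul_left_comm]; ring

theorem weak_id {p q : ℝ} (hpq : p.HolderConjugate q) {z v : EuclideanSpace ℝ (Fin 2)} {R : ℝ}
    (hR : 0 < R) (hv : ‖v‖ < R)
    {A : EuclideanSpace ℝ (Fin 2) → EuclideanSpace ℝ (Fin 2)} {F : EuclideanSpace ℝ (Fin 2) → ℝ}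
    (hA : MemLp A (ENNReal.ofReal p) volume) (hF : MemLp F (ENNReal.ofReal p) volume)
    (hsol : ∀ φ : EuclideanSpace ℝ (Fin 2) → ℝ, ContDiff ℝ 1 φ → HasCompactSupport φ →
      tsupport φ ⊆ ball z (4 * R) → ∫ x, ⟪A x, gradient φ x⟫ = ∫ x, F x * φ x)
    {η : EuclideanSpace ℝ (Fin 2) → ℝ} (hη : ContDiff ℝ 1 η) (hηs : tsupport η ⊆ closedBall z R)
    {U : EuclideanSpace ℝ (Fin 2) → ℝ} {D : EuclideanSpace ℝ (Fin 2) → EuclideanSpace ℝ (Fin 2)}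
    (hU : MemLp U (ENNReal.ofReal q) volume) (hD : MemLp D (ENNReal.ofReal q) volume)
    {w : ℕ → EuclideanSpace ℝ (Fin 2) → ℝ}
    {X : ℕ → EuclideanSpace ℝ (Fin 2) → EuclideanSpace ℝ (Fin 2)}
    (hw : ∀ k, ContDiff ℝ 1 (w k)) (hX : ∀ k, ∀ x ∈ ball z (3 * R), gradient (w k) x = X k x)
    (hXm : ∀ k, AEStronglyMeasurable (X k) volume) 
    (hwl : Filter.Tendsto (fun k => eLpNorm (fun x => w k x - U x) (ENNReal.ofReal q) volume)
        Filter.atTop (nhds 0))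
    (hXl : Filter.Tendsto (fun k => eLpNorm (fun x => X k x - D x) (ENNReal.ofReal q) volume)
        Filter.atTop (nhds 0)) :
    Integrable (fun x => η x ^ 2 * ⟪A (x + v) - A x, D (x + v) - D x⟫) volume ∧
    Integrable (fun x => 2 * η x * ⟪A (x + v) - A x, gradient η x⟫ * (U (x + v) - U x)) volume ∧
    Integrable (fun x => η x ^ 2 * (F (x + v) - F x) * (U (x + v) - U x)) volume ∧
    (∫ x, η x ^ 2 * ⟪A (x + v) - A x, D (x + v) - D x⟫) +
      (∫ x, 2 * η x * ⟪A (x + v) - A x, gradient η x⟫ * (U (x + v) - U x)) =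
    ∫ x, η x ^ 2 * (F (x + v) - F x) * (U (x + v) - U x) := by
  have hQ1 : 1 ≤ ENNReal.ofReal q := by simpa using hpq.symm.lt.le
  have hmp : MeasurePreserving (fun x : EuclideanSpace ℝ (Fin 2) => x + v) volume volume :=
    measurePreserving_add_right volume _
  have hηc : HasCompactSupport η :=
    HasCompactSupport.of_support_subset_isCompact (isCompact_closedBall z R)
      ((subset_tsupport η).trans hηs)
  have hτA : MemLp (fun x => A (x + v) - A x) (ENNReal.ofReal p) volume :=
    (hA.comp_measurePreserving hmp).sub hA
  have hτF : MemLp (fun x => F (x + v) - F x) (ENNReal.ofReal p) volume :=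
    (hF.comp_measurePreserving hmp).sub hF
  have hτD : MemLp (fun x => D (x + v) - D x) (ENNReal.ofReal q) volume :=
    (hD.comp_measurePreserving hmp).sub hD
  have hτU : MemLp (fun x => U (x + v) - U x) (ENNReal.ofReal q) volume :=
    (hU.comp_measurePreserving hmp).sub hU
  have hη2c : HasCompactSupport (fun x => η x ^ 2) := hηc.comp_left (g := fun t : ℝ => t ^ 2) (by simp)
  have h1 : MemLp (fun x => (η x ^ 2) • (A (x + v) - A x)) (ENNReal.ofReal p) volume :=
    memLp_bdd_smul (hη.continuous.pow 2) hη2c hτA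
  have h2 : MemLp (fun x => 2 * η x * ⟪A (x + v) - A x, gradient η x⟫) (ENNReal.ofReal p) volume :=
    memLp_psi2 hη hηc hτA
  have h3 : MemLp (fun x => (η x ^ 2) • (F (x + v) - F x)) (ENNReal.ofReal p) volume :=
    memLp_bdd_smul (hη.continuous.pow 2) hη2c hτF
  have e1 : (fun x => η x ^ 2 * ⟪A (x + v) - A x, D (x + v) - D x⟫) =
      fun x => ⟪(η x ^ 2) • (A (x + v) - A x), D (x + v) - D x⟫ := by
    funext x; rw [real_inner_smul_left]
  have e2 : (fun x => 2 * η x * ⟪A (x + v) - A x, gradient η x⟫ * (U (x + v) - U x)) =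
      fun x => ⟪2 * η x * ⟪A (x + v) - A x, gradient η x⟫, U (x + v) - U x⟫ := by
    funext x; rw [inner_real_mul]
  have e3 : (fun x => η x ^ 2 * (F (x + v) - F x) * (U (x + v) - U x)) =
      fun x => ⟪η x ^ 2 • (F (x + v) - F x), U (x + v) - U x⟫ := by
    funext x; rw [inner_real_mul, smul_eq_mul]
  rw [e1, e2, e3]
  refine ⟨pair_integrable hpq h1 hτD, pair_integrable hpq h2 hτU, pair_integrable hpq h3 hτU, ?_⟩
  have hwk : ∀ᶠ k in Filter.atTop, MemLp (w k) (ENNReal.ofReal q) volume := by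
    filter_upwards [hwl.eventually (gt_mem_nhds (ENNReal.zero_lt_top))] with k hk
    have : MemLp (fun x => w k x - U x) (ENNReal.ofReal q) volume :=
      ⟨(hw k).continuous.aestronglyMeasurable.sub hU.1, hk⟩
    have h := this.add hU
    have h' : (fun x => w k x - U x) + U = w k := by funext x; simp
    rwa [h'] at h
  have hXk : ∀ᶠ k in Filter.atTop, MemLp (X k) (ENNReal.ofReal q) volume := by
    filter_upwards [hXl.eventually (gt_mem_nhds (ENNReal.zero_lt_top))] with k hk
    have : MemLp (fun x => X k x - D x) (ENNReal.ofReal q) volume := ⟨(hXm k).sub hD.1, hk⟩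
    have h := this.add hD
    have h' : (fun x => X k x - D x) + D = X k := by funext x; simp
    rwa [h'] at h
  have tau_lim : ∀ {G : Type} [NormedAddCommGroup G] {Z : ℕ → EuclideanSpace ℝ (Fin 2) → G}
      {Y : EuclideanSpace ℝ (Fin 2) → G}, (∀ k, AEStronglyMeasurable (Z k) volume) →
      AEStronglyMeasurable Y volume →
      Filter.Tendsto (fun k => eLpNorm (fun x => Z k x - Y x) (ENNReal.ofReal q) volume)
        Filter.atTop (nhds 0) →
      Filter.Tendsto (fun k => eLpNorm (fun x => (Z k (x + v) - Z k x) - (Y (x + v) - Y x))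
        (ENNReal.ofReal q) volume) Filter.atTop (nhds 0) := by
    intro G _ Z Y hZ hY hl
    have hl2 := hl.add hl
    rw [add_zero] at hl2
    refine tendsto_of_tendsto_of_tendsto_of_le_of_le tendsto_const_nhds hl2
      (fun k => zero_le) (fun k => ?_)
    have m1 : AEStronglyMeasurable (fun x => Z k x - Y x) volume := (hZ k).sub hY
    have m2 : AEStronglyMeasurable (fun x => Z k (x + v) - Y (x + v)) volume :=
      m1.comp_measurePreserving hmp
    have e : (fun x => (Z k (x + v) - Z k x) - (Y (x + v) - Y x)) =
        (fun x => Z k (x + v) - Y (x + v)) - fun x => Z k x - Y x := by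
      funext x; simp only [Pi.sub_apply]; abel
    simp only
    rw [e]
    refine (eLpNorm_sub_le m2 m1 hQ1).trans ?_
    refine add_le_add (le_of_eq ?_) le_rfl
    have := eLpNorm_comp_measurePreserving (p := ENNReal.ofReal q) m1 hmp
    exact this
  have lw := tau_lim (fun k => (hw k).continuous.aestronglyMeasurable) hU.1 hwl
  have lX := tau_lim hXm hD.1 hXl
  have hτwk : ∀ᶠ k in Filter.atTop, MemLp (fun x => w k (x + v) - w k x) (ENNReal.ofReal q) volume := by
    filter_upwards [hwk] with k hk
    exact (hk.comp_measurePreserving hmp).sub hk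
  have hτXk : ∀ᶠ k in Filter.atTop, MemLp (fun x => X k (x + v) - X k x) (ENNReal.ofReal q) volume := by
    filter_upwards [hXk] with k hk
    exact (hk.comp_measurePreserving hmp).sub hk
  have t1 := pair_tendsto hpq h1 hτD hτXk lX
  have t2 := pair_tendsto hpq h2 hτU hτwk lw
  have t3 := pair_tendsto hpq h3 hτU hτwk lw
  refine tendsto_nhds_unique (t1.add t2) (t3.congr' ?_)
  filter_upwards [hwk, hXk] with k hk1 hk2
  exact (weak_id_smooth hpq hR hv hA hF hsol hη hηs (hw k) (hX k) hk1 hk2).symm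

theorem pt_young {q S t h : ℝ} (hq : 2 ≤ q) (hS : 0 ≤ S) (hh : h ≠ 0) :
    S ^ (q - 2) * t ^ 2 ≤ h ^ 2 * (S ^ q + |t| ^ q / |h| ^ q) := by
  have hh' : 0 < |h| := abs_pos.2 hh
  set w := |t| / |h| with hw
  have hw0 : 0 ≤ w := by positivity
  have ht : t ^ 2 = h ^ 2 * w ^ 2 := by
    rw [hw, div_pow, sq_abs, sq_abs]; field_simp
  have hwq : |t| ^ q / |h| ^ q = w ^ q := by rw [hw, Real.div_rpow (abs_nonneg _) (abs_nonneg _)]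
  have hpow : ∀ a : ℝ, 0 ≤ a → a ^ (q - 2) * a ^ 2 = a ^ q := by
    intro a ha
    rw [← Real.rpow_two, ← Real.rpow_add_of_nonneg ha (by linarith) (by norm_num)]
    congr 1; ring
  rw [hwq, ht]
  have key : S ^ (q - 2) * w ^ 2 ≤ S ^ q + w ^ q := by
    rcases le_total w S with h1 | h1
    · have : S ^ (q - 2) * w ^ 2 ≤ S ^ (q - 2) * S ^ 2 := by gcongr
      rw [hpow S hS] at this
      have : 0 ≤ w ^ q := by positivity
      linarith
    · have : S ^ (q - 2) * w ^ 2 ≤ w ^ (q - 2) * w ^ 2 := by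
        gcongr
      rw [hpow w hw0] at this
      have : 0 ≤ S ^ q := by positivity
      linarith
  nlinarith [sq_nonneg h]

theorem pt_young2 {p q α s t h : ℝ} (hpq : p.HolderConjugate q) (hh : h ≠ 0) :
    |s * t| ≤ |h| ^ (1 + α) * (|s| ^ p / |h| ^ (α * p) + |t| ^ q / |h| ^ q) := by
  have hh' : 0 < |h| := abs_pos.2 hh
  have h1 := Real.young_inequality_of_nonneg (a := |s| / |h| ^ α) (b := |t| / |h|)
    (by positivity) (by positivity) hpq
  have e1 : (|s| / |h| ^ α) ^ p = |s| ^ p / |h| ^ (α * p) := by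
    rw [Real.div_rpow (abs_nonneg _) (by positivity), Real.rpow_mul hh'.le]
  have e2 : (|t| / |h|) ^ q = |t| ^ q / |h| ^ q := by rw [Real.div_rpow (abs_nonneg _) (abs_nonneg _)]
  have d1 : (|s| / |h| ^ α) ^ p / p ≤ (|s| / |h| ^ α) ^ p := div_le_self (by positivity) hpq.lt.le
  have d2 : (|t| / |h|) ^ q / q ≤ (|t| / |h|) ^ q := div_le_self (by positivity) hpq.symm.lt.le
  rw [← e1, ← e2]
  have e3 : |s * t| = |h| ^ (1 + α) * (|s| / |h| ^ α * (|t| / |h|)) := by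
    rw [abs_mul, Real.rpow_add hh', Real.rpow_one]
    field_simp
  rw [e3]
  gcongr
  linarith

theorem pt_cross {q η Q T L S a t : ℝ} (hη : 0 ≤ η) (hQ : 0 ≤ Q) (hL : 0 ≤ L) (hS : 0 ≤ S) (hq : 0 ≤ q)
    (hT0 : 0 ≤ T) (hT : T ^ 2 ≤ q * S * Q) (ha : |a| ≤ T * L) :
    |2 * η * a * t| ≤ 1 / 2 * (η ^ 2 * Q) + 2 * (L ^ 2 * q) * (S * t ^ 2) := by
  have h1 : |2 * η * a * t| ≤ 2 * η * (T * L) * |t| := by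
    rw [abs_mul, abs_mul, abs_mul, abs_of_nonneg hη, abs_two]
    gcongr
  have hX0 : 0 ≤ 2 * η * (T * L) * |t| := by positivity
  refine h1.trans ?_
  have hR : 0 ≤ 1 / 2 * (η ^ 2 * Q) + 2 * (L ^ 2 * q) * (S * t ^ 2) := by positivity
  refine abs_le_of_sq_le_sq' ?_ hR |>.2
  have h2 : (2 * η * (T * L) * |t|) ^ 2 = 4 * (η ^ 2 * L ^ 2 * t ^ 2) * T ^ 2 := by
    rw [mul_pow, sq_abs]; ring
  rw [h2]
  have h3 : 4 * (η ^ 2 * L ^ 2 * t ^ 2) * T ^ 2 ≤ 4 * (η ^ 2 * L ^ 2 * t ^ 2) * (q * S * Q) := by gcongr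
  refine h3.trans ?_
  nlinarith [sq_nonneg (1 / 2 * (η ^ 2 * Q) - 2 * (L ^ 2 * q) * (S * t ^ 2))]

theorem energy_est {E : Type*} [NormedAddCommGroup E] [InnerProductSpace ℝ E] [MeasurableSpace E]
    {μ : Measure E} {p q α h L N1 N2 M : ℝ}
    (hpq : p.HolderConjugate q) (hq : 2 ≤ q) (hα1 : α ≤ 1) (hh : h ≠ 0) (hh1 : |h| ≤ 1)
    (hL : 0 ≤ L) {B : Set E} (hB : MeasurableSet B) {η t s S : E → ℝ} {T Y G : E → E}
    (hη0 : ∀ x, 0 ≤ η x) (hη1 : ∀ x, η x ≤ 1) (hηB : ∀ x, x ∉ B → η x = 0)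
    (hG : ∀ x, ‖G x‖ ≤ L) (hS : ∀ x, 0 ≤ S x)
    (hQ0 : ∀ x, 0 ≤ ⟪T x, Y x⟫) (hT : ∀ x, ‖T x‖ ^ 2 ≤ q * (S x) ^ (q - 2) * ⟪T x, Y x⟫)
    (i1 : Integrable (fun x => η x ^ 2 * ⟪T x, Y x⟫) μ)
    (i2 : Integrable (fun x => 2 * η x * ⟪T x, G x⟫ * t x) μ)
    (i3 : Integrable (fun x => η x ^ 2 * s x * t x) μ)
    (hid : (∫ x, η x ^ 2 * ⟪T x, Y x⟫ ∂μ) + (∫ x, 2 * η x * ⟪T x, G x⟫ * t x ∂μ) =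
      ∫ x, η x ^ 2 * s x * t x ∂μ)
    (iS : IntegrableOn (fun x => S x ^ q) B μ) (it : IntegrableOn (fun x => |t x| ^ q) B μ)
    (is : IntegrableOn (fun x => |s x| ^ p) B μ)
    (bS : ∫ x in B, S x ^ q ∂μ ≤ N1) (bt : ∫ x in B, |t x| ^ q ∂μ ≤ |h| ^ q * N2)
    (bs : ∫ x in B, |s x| ^ p ∂μ ≤ |h| ^ (α * p) * M) :
    ∫ x, η x ^ 2 * ⟪T x, Y x⟫ ∂μ ≤ (4 * (L ^ 2 * q) * (N1 + N2) + 2 * (M + N2)) * |h| ^ (1 + α) := by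
  have hh' : 0 < |h| := abs_pos.2 hh
  set Ξ : E → ℝ := fun x => 2 * (L ^ 2 * q) * h ^ 2 * (S x ^ q + |t x| ^ q / |h| ^ q) +
    |h| ^ (1 + α) * (|s x| ^ p / |h| ^ (α * p) + |t x| ^ q / |h| ^ q) with hΞ
  have iΞ1 : IntegrableOn (fun x => S x ^ q + |t x| ^ q / |h| ^ q) B μ := iS.add (it.div_const _)
  have iΞ2 : IntegrableOn (fun x => |s x| ^ p / |h| ^ (α * p) + |t x| ^ q / |h| ^ q) B μ :=
    (is.div_const _).add (it.div_const _)
  have iΞ : IntegrableOn Ξ B μ := (iΞ1.const_mul _).add (iΞ2.const_mul _)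
  have bΞ : ∫ x in B, Ξ x ∂μ ≤ 2 * (L ^ 2 * q) * h ^ 2 * (N1 + N2) + |h| ^ (1 + α) * (M + N2) := by
    have c1 : (∫ x in B, |t x| ^ q ∂μ) / |h| ^ q ≤ N2 := by
      rw [div_le_iff₀ (by positivity)]; linarith
    have c2 : (∫ x in B, |s x| ^ p ∂μ) / |h| ^ (α * p) ≤ M := by
      rw [div_le_iff₀ (by positivity)]; linarith
    have e : ∫ x in B, Ξ x ∂μ = 2 * (L ^ 2 * q) * h ^ 2 * ((∫ x in B, S x ^ q ∂μ) +
        (∫ x in B, |t x| ^ q ∂μ) / |h| ^ q) + |h| ^ (1 + α) * ((∫ x in B, |s x| ^ p ∂μ) / |h| ^ (α * p) +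
        (∫ x in B, |t x| ^ q ∂μ) / |h| ^ q) := by
      rw [hΞ, integral_add (iΞ1.const_mul _) (iΞ2.const_mul _), integral_const_mul, integral_const_mul,
        integral_add iS (it.div_const _), integral_add (is.div_const _) (it.div_const _),
        integral_div, integral_div]
    rw [e]
    gcongr
  have hpt : ∀ x, η x ^ 2 * s x * t x - 2 * η x * ⟪T x, G x⟫ * t x ≤
      1 / 2 * (η x ^ 2 * ⟪T x, Y x⟫) + B.indicator Ξ x := by
    intro x
    by_cases hx : x ∈ B
    · rw [Set.indicator_of_mem hx]
      have a1 := pt_cross (q := q) (t := t x) (a := ⟪T x, G x⟫) (hη0 x) (hQ0 x) hL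
        (Real.rpow_nonneg (hS x) (q - 2))
        (by linarith) (norm_nonneg _) (hT x) ((abs_real_inner_le_norm _ _).trans (by
          gcongr; exact hG x))
      have a2 := pt_young (t := t x) hq (hS x) hh
      have a3 := pt_young2 (α := α) (s := s x) (t := t x) hpq hh
      have a4 : η x ^ 2 * s x * t x ≤ |s x * t x| := by
        have : η x ^ 2 ≤ 1 := pow_le_one₀ (hη0 x) (hη1 x)
        have h5 := le_abs_self (s x * t x)
        have h6 := abs_nonneg (s x * t x)
        nlinarith [sq_nonneg (η x)]
      have a5 := neg_le_abs (2 * η x * ⟪T x, G x⟫ * t x)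
      have a6 : 2 * (L ^ 2 * q) * (S x ^ (q - 2) * t x ^ 2) ≤
          2 * (L ^ 2 * q) * (h ^ 2 * (S x ^ q + |t x| ^ q / |h| ^ q)) := by gcongr
      simp only [hΞ]
      nlinarith
    · rw [Set.indicator_of_notMem hx, hηB x hx]; simp
  have hint : (∫ x, (η x ^ 2 * s x * t x - 2 * η x * ⟪T x, G x⟫ * t x) ∂μ) ≤
      ∫ x, (1 / 2 * (η x ^ 2 * ⟪T x, Y x⟫) + B.indicator Ξ x) ∂μ := integral_mono (i3.sub i2)
    ((i1.const_mul (1 / 2)).add (iΞ.integrable_indicator hB)) hpt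
  have e1 := integral_sub i3 i2
  have e2 := integral_add (i1.const_mul (1 / 2)) (iΞ.integrable_indicator hB)
  rw [e1, e2, integral_const_mul, integral_indicator hB] at hint
  have hle : ∫ x, η x ^ 2 * ⟪T x, Y x⟫ ∂μ ≤ 2 * ∫ x in B, Ξ x ∂μ := by linarith
  have hpow : h ^ 2 ≤ |h| ^ (1 + α) := by
    rw [← sq_abs, ← Real.rpow_two]
    exact Real.rpow_le_rpow_of_exponent_ge hh' hh1 (by linarith)
  have hN1 : 0 ≤ N1 := le_trans (integral_nonneg fun x => Real.rpow_nonneg (hS x) _) bS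
  have hN2 : 0 ≤ N2 := by
    have : 0 ≤ |h| ^ q * N2 := le_trans (integral_nonneg fun x => by positivity) bt
    exact nonneg_of_mul_nonneg_right this (by positivity)
  have : 2 * (L ^ 2 * q) * h ^ 2 * (N1 + N2) ≤ 2 * (L ^ 2 * q) * |h| ^ (1 + α) * (N1 + N2) := by gcongr
  nlinarith

theorem hmap_norm_le {q : ℝ} (hq : 2 ≤ q) (ξ : EuclideanSpace ℝ (Fin 2)) :
    ‖Hmap 2 (q - 1) ξ‖ ≤ ‖ξ‖ ^ (q - 1) := by
  unfold Hmap
  have hm : 0 ≤ max (‖ξ‖ - 1) 0 := le_max_right _ _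
  by_cases h : ξ = 0
  · subst h; simp; positivity
  · have hp : 0 < ‖ξ‖ := norm_pos_iff.2 h
    rw [norm_smul, Real.norm_eq_abs, abs_of_nonneg (by positivity), div_mul_cancel₀ _ hp.ne']
    apply Real.rpow_le_rpow hm _ (by linarith)
    exact max_le (by linarith) hp.le

theorem hmap_measurable (a : ℝ) : Measurable (Hmap 2 a) := by
  unfold Hmap
  fun_prop

theorem hmap_memLp {p q : ℝ} (hpq : p.HolderConjugate q) (hq : 2 ≤ q)
    {D : EuclideanSpace ℝ (Fin 2) → EuclideanSpace ℝ (Fin 2)}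
    {μ : Measure (EuclideanSpace ℝ (Fin 2))}
    (hD : MemLp D (ENNReal.ofReal q) μ) :
    MemLp (fun x => Hmap 2 (q - 1) (D x)) (ENNReal.ofReal p) μ := by
  have hq1 : 0 < q - 1 := by linarith
  have h1 := hD.norm_rpow_div (ENNReal.ofReal (q - 1))
  rw [← ENNReal.ofReal_div_of_pos hq1, ENNReal.toReal_ofReal hq1.le,
    ← hpq.symm.conjugate_eq] at h1
  refine h1.mono ((hmap_measurable _).comp_aemeasurable hD.1.aemeasurable).aestronglyMeasurable
    (Filter.Eventually.of_forall fun x => ?_)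
  rw [Real.norm_of_nonneg (by positivity)]
  exact hmap_norm_le hq _

theorem unitVec_norm (i : Fin 2) : ‖unitVec 2 i‖ = 1 := by
  simp [unitVec]

theorem integrable_rpow_of_memLp {F : Type*} [NormedAddCommGroup F] {q : ℝ} (hq : 0 < q)
    {g : EuclideanSpace ℝ (Fin 2) → F} {μ : Measure (EuclideanSpace ℝ (Fin 2))}
    (hg : MemLp g (ENNReal.ofReal q) μ) : Integrable (fun x => ‖g x‖ ^ q) μ := by
  have := hg.integrable_norm_rpow (by simpa using hq) ENNReal.ofReal_ne_top
  rwa [ENNReal.toReal_ofReal hq.le] at this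

theorem energy_core {p q α R M L : ℝ} (hpq : p.HolderConjugate q) (hq : 2 ≤ q) (hα1 : α < 1)
    (hR : 0 < R) (hR1 : R ≤ 1) {z : EuclideanSpace ℝ (Fin 2)}
    {U F : EuclideanSpace ℝ (Fin 2) → ℝ} {D : EuclideanSpace ℝ (Fin 2) → EuclideanSpace ℝ (Fin 2)}
    (hU : MemLp U (ENNReal.ofReal q) volume) (hD : MemLp D (ENNReal.ofReal q) volume)
    (hF : MemLp F (ENNReal.ofReal p) volume)
    (hweak : ∀ φ : EuclideanSpace ℝ (Fin 2) → ℝ, ContDiff ℝ 1 φ → HasCompactSupport φ →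
      tsupport φ ⊆ ball z (4 * R) → ∫ x, U x • gradient φ x = -∫ x, φ x • D x)
    (hsol : ∀ φ : EuclideanSpace ℝ (Fin 2) → ℝ, ContDiff ℝ 1 φ → HasCompactSupport φ →
      tsupport φ ⊆ ball z (4 * R) →
      ∫ x, ⟪Hmap 2 (q - 1) (D x), gradient φ x⟫ = ∫ x, F x * φ x)
    (hbes : ∀ (i : Fin 2) (h : ℝ), h ≠ 0 → |h| < R →
      ∫ x in ball z R, |F (x + h • unitVec 2 i) - F x| ^ p ≤ |h| ^ (α * p) * M)
    {η : EuclideanSpace ℝ (Fin 2) → ℝ} (hη : ContDiff ℝ 1 η) (hηs : tsupport η ⊆ closedBall z R)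
    (hη0 : ∀ x, 0 ≤ η x) (hη1 : ∀ x, η x ≤ 1) (hηB : ∀ x, x ∉ ball z R → η x = 0) (hL : 0 ≤ L)
    (hG : ∀ x, ‖gradient η x‖ ≤ L) :
    ∃ C : ℝ, 0 ≤ C ∧ ∀ (i : Fin 2) (h : ℝ), h ≠ 0 → |h| < R →
      Integrable (fun x => η x ^ 2 * ⟪Hmap 2 (q - 1) (D (x + h • unitVec 2 i)) -
        Hmap 2 (q - 1) (D x), D (x + h • unitVec 2 i) - D x⟫) volume ∧
      ∫ x, η x ^ 2 * ⟪Hmap 2 (q - 1) (D (x + h • unitVec 2 i)) -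
        Hmap 2 (q - 1) (D x), D (x + h • unitVec 2 i) - D x⟫ ≤ C * |h| ^ (1 + α) := by
  have hq0 : 0 < q := by linarith
  obtain ⟨w, X, hw, hX, hXm, hwl, hXl⟩ := approx_w1 (by linarith) hR hU hD hweak
  have hA := hmap_memLp hpq hq hD
  have iD : Integrable (fun x => ‖D x‖ ^ q) volume := integrable_rpow_of_memLp hq0 hD
  set N := ∫ x, ‖D x‖ ^ q with hN
  have hN0 : 0 ≤ N := integral_nonneg fun x => by positivity
  have hM0 : 0 ≤ M := by
    have h1 := hbes 0 (R / 2) (by positivity) (by rw [abs_of_pos (by positivity)]; linarith)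
    have h2 : 0 ≤ |R / 2| ^ (α * p) * M :=
      le_trans (integral_nonneg fun x => by positivity) h1
    exact nonneg_of_mul_nonneg_right h2 (by rw [abs_of_pos (by positivity)]; positivity)
  refine ⟨4 * (L ^ 2 * q) * (2 ^ q * (N + N) + N) + 2 * (M + N), by positivity, fun i h hh hhR => ?_⟩
  set v := h • unitVec 2 i with hv
  have hvn : ‖v‖ < R := by rw [hv, norm_smul, unitVec_norm, mul_one]; exact hhR
  have hmp : MeasurePreserving (fun x : EuclideanSpace ℝ (Fin 2) => x + v) volume volume :=
    measurePreserving_add_right volume _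
  obtain ⟨i1, i2, i3, hid⟩ := weak_id hpq hR hvn hA hF hsol hη hηs hU hD hw hX hXm hwl hXl
  have hdq := dq_limit (z := z) (h := h) (by linarith) (unitVec_norm i) hhR hU hD hw hX hXm hwl hXl
  rw [← hv] at hdq
  have hDv : MemLp (fun x => D (x + v)) (ENNReal.ofReal q) volume := hD.comp_measurePreserving hmp
  have iDv : Integrable (fun x => ‖D (x + v)‖ ^ q) volume := integrable_rpow_of_memLp hq0 hDv
  have eDv : ∫ x, ‖D (x + v)‖ ^ q = N := integral_add_right_eq_self (μ := volume) (fun x => ‖D x‖ ^ q) v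
  have it : Integrable (fun x => |U (x + v) - U x| ^ q) volume :=
    integrable_rpow_of_memLp hq0 ((hU.comp_measurePreserving hmp).sub hU)
  have is : Integrable (fun x => |F (x + v) - F x| ^ p) volume :=
    integrable_rpow_of_memLp hpq.pos ((hF.comp_measurePreserving hmp).sub hF)
  have hSle : ∀ x, (‖D (x + v)‖ + ‖D x‖) ^ q ≤ 2 ^ q * (‖D (x + v)‖ ^ q + ‖D x‖ ^ q) := by
    intro x
    have key : ∀ a b : ℝ, 0 ≤ a → 0 ≤ b → a ≤ b → (a + b) ^ q ≤ 2 ^ q * (a ^ q + b ^ q) := by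
      intro a b ha hb hab
      calc (a + b) ^ q ≤ (2 * b) ^ q := by
            apply Real.rpow_le_rpow (by positivity) (by linarith) hq0.le
        _ = 2 ^ q * b ^ q := Real.mul_rpow (by norm_num) hb
        _ ≤ _ := by
            have : 0 ≤ a ^ q := by positivity
            gcongr; linarith
    rcases le_total ‖D (x + v)‖ ‖D x‖ with h1 | h1
    · exact key _ _ (norm_nonneg _) (norm_nonneg _) h1
    · rw [add_comm, add_comm (‖D (x + v)‖ ^ q)]
      exact key _ _ (norm_nonneg _) (norm_nonneg _) h1
  have iSb : Integrable (fun x => 2 ^ q * (‖D (x + v)‖ ^ q + ‖D x‖ ^ q)) volume :=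
    (iDv.add iD).const_mul _
  have iS : Integrable (fun x => (‖D (x + v)‖ + ‖D x‖) ^ q) volume := by
    refine iSb.mono' ?_ (Filter.Eventually.of_forall fun x => ?_)
    · exact ((hDv.1.norm.add hD.1.norm).aemeasurable.pow_const q).aestronglyMeasurable
    · rw [Real.norm_of_nonneg (by positivity)]; exact hSle x
  have bS : ∫ x in ball z R, (‖D (x + v)‖ + ‖D x‖) ^ q ≤ 2 ^ q * (N + N) := by
    refine (setIntegral_le_integral iS (Filter.Eventually.of_forall fun x => ?_)).trans ?_
    · show 0 ≤ (‖D (x + v)‖ + ‖D x‖) ^ q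
      positivity
    · refine (integral_mono iS iSb hSle).trans (le_of_eq ?_)
      rw [integral_const_mul, integral_add iDv iD, eDv]
  have bt : ∫ x in ball z R, |U (x + v) - U x| ^ q ≤ |h| ^ q * N := by
    have h1 : ENNReal.ofReal (∫ x in ball z R, |U (x + v) - U x| ^ q) ≤ ENNReal.ofReal (|h| ^ q * N) := by
      rw [ofReal_integral_eq_lintegral_ofReal it.integrableOn
        (Filter.Eventually.of_forall fun x => by positivity), ENNReal.ofReal_mul (by positivity), hN,
        ofReal_integral_eq_lintegral_ofReal iD (Filter.Eventually.of_forall fun x => by positivity)]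
      have conv : ∀ {G : Type} [NormedAddCommGroup G] (a : G), ENNReal.ofReal (‖a‖ ^ q) = ‖a‖ₑ ^ q := by
        intro G _ a
        rw [← ENNReal.ofReal_rpow_of_nonneg (norm_nonneg _) hq0.le, ofReal_norm]
      simp_rw [← Real.norm_eq_abs, conv]
      refine le_trans (lintegral_mono_set (ball_subset_ball (by linarith))) hdq
    exact (ENNReal.ofReal_le_ofReal_iff (by positivity)).1 h1
  refine ⟨i1, ?_⟩
  exact energy_est hpq hq hα1.le hh (hhR.le.trans hR1) hL measurableSet_ball hη0 hη1 hηB hG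
    (S := fun x => ‖D (x + v)‖ + ‖D x‖) (fun x => by positivity)
    (fun x => (hmap_ineq hq _ _).2.2) (fun x => (hmap_ineq hq _ _).2.1) i1 i2 i3 hid
    iS.integrableOn it.integrableOn is.integrableOn bS bt (hbes i h hh hhR)

theorem tau_prod_le {q η ηv a b gQ L h N : ℝ} (h1 : (b - a) ^ 2 ≤ q ^ 2 * gQ) (h2 : |ηv - η| ≤ L * |h|)
    (hb : b ^ 2 ≤ N) :
    (ηv * b - η * a) ^ 2 ≤ 2 * q ^ 2 * (η ^ 2 * gQ) + 2 * L ^ 2 * h ^ 2 * N := by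
  have e : ηv * b - η * a = η * (b - a) + (ηv - η) * b := by ring
  rw [e]
  have h3 : (ηv - η) ^ 2 ≤ L ^ 2 * h ^ 2 := by
    rw [← sq_abs h, ← mul_pow, ← sq_abs (ηv - η)]
    gcongr
  have h4 : (η * (b - a) + (ηv - η) * b) ^ 2 ≤ 2 * (η * (b - a)) ^ 2 + 2 * ((ηv - η) * b) ^ 2 := by
    nlinarith [sq_nonneg (η * (b - a) - (ηv - η) * b)]
  have h5 : (η * (b - a)) ^ 2 ≤ η ^ 2 * (q ^ 2 * gQ) := by rw [mul_pow]; gcongr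
  have h6 : ((ηv - η) * b) ^ 2 ≤ L ^ 2 * h ^ 2 * N := by rw [mul_pow]; gcongr
  linarith

theorem enorm_sq_eq (a : ℝ) : ‖a‖ₑ ^ 2 = ENNReal.ofReal (a ^ 2) := by
  rw [← ofReal_norm, ← ENNReal.ofReal_pow (norm_nonneg _), Real.norm_eq_abs, sq_abs]

set_option maxHeartbeats 600000 in
theorem core {p q α R M r : ℝ} (hpq : p.HolderConjugate q) (hq : 2 ≤ q) (hα0 : 0 < α) (hα1 : α < 1)
    (hr0 : 0 < r) (hr : 2 * r / q < 4 / (1 - α))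
    (hR : 0 < R) (hR1 : R ≤ 1) {z : EuclideanSpace ℝ (Fin 2)}
    {U F : EuclideanSpace ℝ (Fin 2) → ℝ} {D : EuclideanSpace ℝ (Fin 2) → EuclideanSpace ℝ (Fin 2)}
    (hU : MemLp U (ENNReal.ofReal q) volume) (hD : MemLp D (ENNReal.ofReal q) volume)
    (hF : MemLp F (ENNReal.ofReal p) volume)
    (hweak : ∀ φ : EuclideanSpace ℝ (Fin 2) → ℝ, ContDiff ℝ 1 φ → HasCompactSupport φ →
      tsupport φ ⊆ ball z (4 * R) → ∫ x, U x • gradient φ x = -∫ x, φ x • D x)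
    (hsol : ∀ φ : EuclideanSpace ℝ (Fin 2) → ℝ, ContDiff ℝ 1 φ → HasCompactSupport φ →
      tsupport φ ⊆ ball z (4 * R) →
      ∫ x, ⟪Hmap 2 (q - 1) (D x), gradient φ x⟫ = ∫ x, F x * φ x)
    (hbes : ∀ (i : Fin 2) (h : ℝ), h ≠ 0 → |h| < R →
      ∫ x in ball z R, |F (x + h • unitVec 2 i) - F x| ^ p ≤ |h| ^ (α * p) * M) :
    IntegrableOn (fun x => ‖D x‖ ^ r) (ball z (R / 2)) volume := by
  have hq0 : 0 < q := by linarith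
  let η : ContDiffBump z := ⟨R / 2, R, by positivity, by linarith⟩
  have hη : ContDiff ℝ 1 (η : EuclideanSpace ℝ (Fin 2) → ℝ) := η.contDiff
  have hηs : tsupport (η : EuclideanSpace ℝ (Fin 2) → ℝ) ⊆ closedBall z R := by
    rw [η.tsupport_eq]
  have hη0 : ∀ x, 0 ≤ η x := fun x => η.nonneg
  have hη1 : ∀ x, η x ≤ 1 := fun x => η.le_one
  have hηB : ∀ x, x ∉ ball z R → η x = 0 := by
    intro x hx
    by_contra h
    apply hx
    have : x ∈ Function.support η := h
    rwa [η.support_eq] at this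
  obtain ⟨L, hL⟩ := (continuous_gradient hη).bounded_above_of_compact_support (by
      have := η.hasCompactSupport.fderiv ℝ
      exact this.comp_left (g := (InnerProductSpace.toDual ℝ (EuclideanSpace ℝ (Fin 2))).symm) (map_zero _))
  have hL0 : 0 ≤ L := (norm_nonneg _).trans (hL z)
  obtain ⟨C, hC0, hC⟩ := energy_core hpq hq hα1 hR hR1 hU hD hF hweak hsol hbes hη hηs hη0 hη1 hηB hL0 hL
  have iD : Integrable (fun x => ‖D x‖ ^ q) volume := integrable_rpow_of_memLp hq0 hD
  set N := ∫ x, ‖D x‖ ^ q with hN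
  have hN0 : 0 ≤ N := integral_nonneg fun x => by positivity
  set g : EuclideanSpace ℝ (Fin 2) → ℝ := fun x => (max (‖D x‖ - 1) 0) ^ (q / 2) with hg
  have hg2 : ∀ x, g x ^ 2 ≤ ‖D x‖ ^ q := by
    intro x
    have hm : 0 ≤ max (‖D x‖ - 1) 0 := le_max_right _ _
    simp only [hg]
    rw [← Real.rpow_two, ← Real.rpow_mul hm, div_mul_cancel₀ _ (by norm_num : (2:ℝ) ≠ 0)]
    exact Real.rpow_le_rpow hm (max_le (by linarith) (norm_nonneg _)) hq0.le
  have hgm : AEMeasurable g volume := by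
    have : AEMeasurable (fun x => ‖D x‖) volume := hD.1.norm.aemeasurable
    exact ((this.sub_const 1).max aemeasurable_const).pow_const _
  have hGm : AEMeasurable (fun x => η x * g x) volume := hη.continuous.aemeasurable.mul hgm
  have hGL2 : ∫⁻ x, ‖η x * g x‖ₑ ^ 2 ≠ ∞ := by
    have h1 : ∫⁻ x, ‖η x * g x‖ₑ ^ 2 ≤ ∫⁻ x, ENNReal.ofReal (‖D x‖ ^ q) := by
      refine lintegral_mono fun x => ?_
      rw [enorm_sq_eq]
      apply ENNReal.ofReal_le_ofReal
      rw [mul_pow]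
      have : η x ^ 2 ≤ 1 := pow_le_one₀ (hη0 x) (hη1 x)
      nlinarith [hg2 x, sq_nonneg (g x)]
    refine ne_top_of_le_ne_top ?_ h1
    rw [← ofReal_integral_eq_lintegral_ofReal iD (Filter.Eventually.of_forall fun x => by positivity)]
    exact ENNReal.ofReal_ne_top
  have hlip : ∀ x v : EuclideanSpace ℝ (Fin 2), |η (x + v) - η x| ≤ L * ‖v‖ := by
    intro x v
    have := convex_univ.norm_image_sub_le_of_norm_fderiv_le (𝕜 := ℝ) (f := η) (C := L) (x := x) (y := x + v)
      (fun y _ => hη.differentiable (by norm_num) y)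
      (fun y _ => by rw [← norm_gradient_eq]; exact hL y) (Set.mem_univ _) (Set.mem_univ _)
    simpa using this
  have hvol : volume (ball z (R / 2)) ≠ ∞ := measure_ball_lt_top.ne
  have hbe := besov_embed hGm hGL2 (C := 2 * q ^ 2 * C + 2 * L ^ 2 * N) (s := (1 + α) / 2) (t := 2 * r / q)
    (h0 := R) (by linarith) (by linarith) (by positivity) (by positivity) (by
      have : 2 / (1 - (1 + α) / 2) = 4 / (1 - α) := by
        have : 1 - α ≠ 0 := by linarith
        have : 1 - (1 + α) / 2 ≠ 0 := by intro h; apply this; linarith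
        rw [div_eq_div_iff this (by assumption)]; ring
      rw [this]; exact hr) hR (by
    intro i h hh hhR
    obtain ⟨i1, b1⟩ := hC i h hh hhR
    set v := h • unitVec 2 i with hv
    have hvn : ‖v‖ = |h| := by rw [hv, norm_smul, unitVec_norm, mul_one, Real.norm_eq_abs]
    have hmp : MeasurePreserving (fun x : EuclideanSpace ℝ (Fin 2) => x + v) volume volume :=
      measurePreserving_add_right volume _
    have iDv : Integrable (fun x => ‖D (x + v)‖ ^ q) volume :=
      integrable_rpow_of_memLp hq0 (hD.comp_measurePreserving hmp)
    have eDv : ∫ x, ‖D (x + v)‖ ^ q = N :=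
      integral_add_right_eq_self (μ := volume) (fun x => ‖D x‖ ^ q) v
    have iall := (i1.const_mul (2 * q ^ 2)).add (iDv.const_mul (2 * L ^ 2 * h ^ 2))
    have hQ0 : ∀ x, 0 ≤ ⟪Hmap 2 (q - 1) (D (x + v)) - Hmap 2 (q - 1) (D x), D (x + v) - D x⟫ :=
      fun x => (hmap_ineq hq _ _).2.2
    calc ∫⁻ x, ‖η (x + v) * g (x + v) - η x * g x‖ₑ ^ 2
        ≤ ∫⁻ x, ENNReal.ofReal (2 * q ^ 2 * (η x ^ 2 * ⟪Hmap 2 (q - 1) (D (x + v)) -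
            Hmap 2 (q - 1) (D x), D (x + v) - D x⟫) + 2 * L ^ 2 * h ^ 2 * ‖D (x + v)‖ ^ q) := by
          refine lintegral_mono fun x => ?_
          rw [enorm_sq_eq]
          apply ENNReal.ofReal_le_ofReal
          exact tau_prod_le (hmap_ineq hq _ _).1 (by rw [← hvn]; exact hlip x v) (hg2 _)
      _ = ENNReal.ofReal (∫ x, (2 * q ^ 2 * (η x ^ 2 * ⟪Hmap 2 (q - 1) (D (x + v)) -
            Hmap 2 (q - 1) (D x), D (x + v) - D x⟫) + 2 * L ^ 2 * h ^ 2 * ‖D (x + v)‖ ^ q)) := by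
          refine (ofReal_integral_eq_lintegral_ofReal iall (Filter.Eventually.of_forall fun x => ?_)).symm
          have := hQ0 x
          show 0 ≤ 2 * q ^ 2 * (η x ^ 2 * ⟪Hmap 2 (q - 1) (D (x + v)) -
            Hmap 2 (q - 1) (D x), D (x + v) - D x⟫) + 2 * L ^ 2 * h ^ 2 * ‖D (x + v)‖ ^ q
          positivity
      _ ≤ _ := by
          apply ENNReal.ofReal_le_ofReal
          rw [integral_add (i1.const_mul (2 * q ^ 2)) (iDv.const_mul (2 * L ^ 2 * h ^ 2)),
            integral_const_mul, integral_const_mul, eDv]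
          have e2 : 2 * ((1 + α) / 2) = 1 + α := by ring
          rw [e2]
          have hpow : h ^ 2 ≤ |h| ^ (1 + α) := by
            rw [← sq_abs, ← Real.rpow_two]
            exact Real.rpow_le_rpow_of_exponent_ge (abs_pos.2 hh) (hhR.le.trans hR1) (by linarith)
          have a1 : 2 * q ^ 2 * (∫ x, η x ^ 2 * ⟪Hmap 2 (q - 1) (D (x + v)) -
            Hmap 2 (q - 1) (D x), D (x + v) - D x⟫) ≤ 2 * q ^ 2 * (C * |h| ^ (1 + α)) :=
            mul_le_mul_of_nonneg_left b1 (by positivity)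
          have a2 : 2 * L ^ 2 * h ^ 2 * N ≤ 2 * L ^ 2 * |h| ^ (1 + α) * N :=
            mul_le_mul_of_nonneg_right (mul_le_mul_of_nonneg_left hpow (by positivity)) hN0
          linarith) hvol
  have hbd : ∀ x ∈ ball z (R / 2), ‖D x‖ ^ r ≤ 2 ^ r * (1 + |η x * g x| ^ (2 * r / q)) := by
    intro x hx
    have h1 : η x = 1 := η.one_of_mem_closedBall (ball_subset_closedBall hx)
    have hm : 0 ≤ max (‖D x‖ - 1) 0 := le_max_right _ _
    have h2 : |η x * g x| ^ (2 * r / q) = (max (‖D x‖ - 1) 0) ^ r := by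
      rw [h1, one_mul, abs_of_nonneg (Real.rpow_nonneg hm _)]
      rw [← Real.rpow_mul hm]
      congr 1; field_simp
    rw [h2]
    rcases le_total ‖D x‖ 2 with h3 | h3
    · have : ‖D x‖ ^ r ≤ 2 ^ r := Real.rpow_le_rpow (norm_nonneg _) h3 hr0.le
      have h4 : 0 ≤ (max (‖D x‖ - 1) 0) ^ r := Real.rpow_nonneg hm _
      have h5 : (0:ℝ) ≤ 2 ^ r := by positivity
      nlinarith
    · have h6 : ‖D x‖ ≤ 2 * max (‖D x‖ - 1) 0 := by
        have := le_max_left (‖D x‖ - 1) 0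
        linarith
      have : ‖D x‖ ^ r ≤ (2 * max (‖D x‖ - 1) 0) ^ r := Real.rpow_le_rpow (norm_nonneg _) h6 hr0.le
      rw [Real.mul_rpow (by norm_num) hm] at this
      have h5 : (0:ℝ) ≤ 2 ^ r := by positivity
      nlinarith
  have hGt : IntegrableOn (fun x => |η x * g x| ^ (2 * r / q)) (ball z (R / 2)) volume := by
    refine ⟨((continuous_abs.measurable.comp_aemeasurable hGm).pow_const _).aestronglyMeasurable.restrict, ?_⟩
    rw [hasFiniteIntegral_iff_ofReal (Filter.Eventually.of_forall fun x => by positivity)]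
    exact hbe.lt_top
  have hone : IntegrableOn (fun _ : EuclideanSpace ℝ (Fin 2) => (1 : ℝ)) (ball z (R / 2)) volume :=
    integrableOn_const hvol
  refine Integrable.mono' ((hone.add hGt).const_mul (2 ^ r)) ?_ ?_
  · exact (hD.1.norm.aemeasurable.pow_const _).aestronglyMeasurable.restrict
  · filter_upwards [ae_restrict_mem measurableSet_ball] with x hx
    rw [Real.norm_of_nonneg (by positivity)]
    exact hbd x hx

theorem gradient_zero_off {φ : EuclideanSpace ℝ (Fin 2) → ℝ} {x : EuclideanSpace ℝ (Fin 2)}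
    (hx : x ∉ tsupport φ) : gradient φ x = 0 := by
  unfold gradient
  rw [fderiv_of_notMem_tsupport (𝕜 := ℝ) hx, map_zero]

theorem gradient_add_fun {φ ψ : EuclideanSpace ℝ (Fin 2) → ℝ} (hφ : ContDiff ℝ 1 φ)
    (hψ : ContDiff ℝ 1 ψ) (x : EuclideanSpace ℝ (Fin 2)) :
    gradient (fun y => φ y + ψ y) x = gradient φ x + gradient ψ x := by
  apply ext_inner_right ℝ
  intro e
  rw [inner_add_left, inner_gradient_left, inner_gradient_left, inner_gradient_left]
  have h2 : HasFDerivAt (fun x => φ x + ψ x) _ x :=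
    (hφ.differentiable (by norm_num) x).hasFDerivAt.add (hψ.differentiable (by norm_num) x).hasFDerivAt
  rw [h2.fderiv]
  rfl

theorem pair_test_integrable {p q : ℝ} (hpq : p.HolderConjugate q) (hq : 2 ≤ q)
    {Ω : Set (EuclideanSpace ℝ (Fin 2))}
    {u : EuclideanSpace ℝ (Fin 2) → ℝ} {Du : EuclideanSpace ℝ (Fin 2) → EuclideanSpace ℝ (Fin 2)}
    (hu : MemW1Loc 2 q Ω u Du) {φ : EuclideanSpace ℝ (Fin 2) → ℝ} (hφ : ContDiff ℝ 1 φ)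
    (hc : HasCompactSupport φ) (hs : tsupport φ ⊆ Ω) :
    Integrable (fun x => ⟪Hmap 2 (q - 1) (Du x), gradient φ x⟫) volume := by
  have hK := (hu.1 (tsupport φ) hc hs).2
  have h1 := pair_integrable hpq (hmap_memLp hpq hq hK)
    ((memLp_gradient hφ hc (ENNReal.ofReal q)).restrict (tsupport φ))
  refine (integrableOn_iff_integrable_of_support_subset ?_).1 h1
  intro x hx
  by_contra h
  apply hx
  show ⟪Hmap 2 (q - 1) (Du x), gradient φ x⟫ = 0
  rw [gradient_zero_off h, inner_zero_right]

theorem rhs_data {p q α : ℝ} (hpq : p.HolderConjugate q) (hq : 2 ≤ q)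
    {Ω : Set (EuclideanSpace ℝ (Fin 2))}
    {u f : EuclideanSpace ℝ (Fin 2) → ℝ} {Du : EuclideanSpace ℝ (Fin 2) → EuclideanSpace ℝ (Fin 2)}
    (hu : MemW1Loc 2 q Ω u Du) (hsol : IsLocalWeakSolution 2 q Ω Du f)
    (hf : MemBesovLoc 2 p α Ω f) {z : EuclideanSpace ℝ (Fin 2)} {R : ℝ} (hR : 0 < R)
    (hz : closedBall z (5 * R) ⊆ Ω) :
    ∃ (F : EuclideanSpace ℝ (Fin 2) → ℝ) (M : ℝ), MemLp F (ENNReal.ofReal p) volume ∧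
      (∀ φ : EuclideanSpace ℝ (Fin 2) → ℝ, ContDiff ℝ 1 φ → HasCompactSupport φ →
        tsupport φ ⊆ ball z (4 * R) →
        ∫ x, ⟪Hmap 2 (q - 1) (Du x), gradient φ x⟫ = ∫ x, F x * φ x) ∧
      (∀ (i : Fin 2) (h : ℝ), h ≠ 0 → |h| < R →
        ∫ x in ball z R, |F (x + h • unitVec 2 i) - F x| ^ p ≤ |h| ^ (α * p) * M) := by
  have hp0 : 0 < p := hpq.pos
  have hball : ball z (4 * R) ⊆ Ω :=
    (ball_subset_closedBall.trans (closedBall_subset_closedBall (by linarith))).trans hz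
  have glob : ∀ φ : EuclideanSpace ℝ (Fin 2) → ℝ, ContDiff ℝ 1 φ → HasCompactSupport φ →
      tsupport φ ⊆ Ω → ∫ x, ⟪Hmap 2 (q - 1) (Du x), gradient φ x⟫ = ∫ x, f x * φ x := by
    intro φ h1 h2 h3
    have := hsol φ h1 h2 h3
    rwa [setIntegral_eq_integral_of_forall_compl_eq_zero (fun x hx => by
      rw [gradient_zero_off fun h => hx (h3 h), inner_zero_right]),
      setIntegral_eq_integral_of_forall_compl_eq_zero (fun x hx => by
      rw [image_eq_zero_of_notMem_tsupport fun h => hx (h3 h), mul_zero])] at this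
  by_cases hmeas : ∀ φ : EuclideanSpace ℝ (Fin 2) → ℝ, ContDiff ℝ 1 φ → HasCompactSupport φ →
      tsupport φ ⊆ Ω → AEStronglyMeasurable (fun x => f x * φ x) volume
  · obtain ⟨M0, hM0⟩ := (hf z R hR ((closedBall_subset_closedBall (by linarith)).trans hz)).2
    refine ⟨(ball z (4 * R)).indicator f, (max M0 0) ^ p, ?_, ?_, ?_⟩
    · let η : ContDiffBump z := ⟨4 * R, 5 * R, by positivity, by linarith⟩
      have hm := hmeas η η.contDiff η.hasCompactSupport (by rw [η.tsupport_eq]; exact hz)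
      have hFm : AEStronglyMeasurable ((ball z (4 * R)).indicator f) volume := by
        have : (ball z (4 * R)).indicator f = (ball z (4 * R)).indicator (fun x => f x * η x) := by
          refine Set.indicator_congr fun x hx => ?_
          rw [η.one_of_mem_closedBall (ball_subset_closedBall hx), mul_one]
        rw [this]
        exact hm.indicator measurableSet_ball
      refine (integrable_norm_rpow_iff hFm (by simpa using hp0) ENNReal.ofReal_ne_top).1 ?_
      rw [ENNReal.toReal_ofReal hp0.le]
      have hi := (hf z (4 * R) (by positivity) ((closedBall_subset_closedBall (by linarith)).trans hz)).1
      refine ((integrable_indicator_iff measurableSet_ball).2 hi).congr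
        (Filter.Eventually.of_forall fun x => ?_)
      by_cases hx : x ∈ ball z (4 * R)
      · simp only [Set.indicator_of_mem hx, Real.norm_eq_abs]
      · simp only [Set.indicator_of_notMem hx, norm_zero, Real.zero_rpow hp0.ne']
    · intro φ h1 h2 h3
      rw [glob φ h1 h2 (h3.trans hball)]
      refine integral_congr_ae (Filter.Eventually.of_forall fun x => ?_)
      by_cases hx : x ∈ ball z (4 * R)
      · simp only [Set.indicator_of_mem hx]
      · simp only [image_eq_zero_of_notMem_tsupport fun h => hx (h3 h), mul_zero]
    · intro i h hh hhR
      have hhp : 0 < |h| ^ (α * p) := Real.rpow_pos_of_pos (abs_pos.2 hh) _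
      have hb := hM0 ⟨i, h, hh, rfl⟩
      set J := ∫ x in ball z R, |f (x + h • unitVec 2 i) - f x| ^ p / |h| ^ (α * p) with hJ
      have hJ0 : 0 ≤ J := integral_nonneg fun x => by positivity
      have hJM : J ≤ (max M0 0) ^ p := by
        have h1 : J ^ (1 / p) ≤ max M0 0 := hb.trans (le_max_left _ _)
        have h2 := Real.rpow_le_rpow (by positivity) h1 hp0.le
        rwa [← Real.rpow_mul hJ0, one_div, inv_mul_cancel₀ hp0.ne', Real.rpow_one] at h2
      have e : ∫ x in ball z R, |(ball z (4 * R)).indicator f (x + h • unitVec 2 i) -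
          (ball z (4 * R)).indicator f x| ^ p = |h| ^ (α * p) * J := by
        rw [hJ, ← integral_const_mul]
        refine setIntegral_congr_fun measurableSet_ball fun x hx => ?_
        rw [mem_ball, dist_eq_norm] at hx
        have a1 : x ∈ ball z (4 * R) := by rw [mem_ball, dist_eq_norm]; linarith
        have a2 : x + h • unitVec 2 i ∈ ball z (4 * R) := by
          rw [mem_ball, dist_eq_norm]
          have h3 := norm_add_le (x - z) (h • unitVec 2 i)
          have h4 : x - z + h • unitVec 2 i = x + h • unitVec 2 i - z := by abel
          rw [h4, norm_smul, unitVec_norm, mul_one, Real.norm_eq_abs] at h3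
          linarith
        simp only [Set.indicator_of_mem a1, Set.indicator_of_mem a2]
        field_simp
      rw [e]
      gcongr
  · push Not at hmeas
    obtain ⟨φ0, h01, h02, h03, h0⟩ := hmeas
    have z0 : ∫ x, ⟪Hmap 2 (q - 1) (Du x), gradient φ0 x⟫ = 0 := by
      rw [glob φ0 h01 h02 h03]
      exact integral_undef fun h => h0 h.1
    refine ⟨fun _ => 0, 0, MemLp.zero, ?_, ?_⟩
    · intro φ h1 h2 h3
      have h3' := h3.trans hball
      simp only [zero_mul, integral_zero]
      by_cases hm : AEStronglyMeasurable (fun x => f x * φ x) volume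
      · have hsub : tsupport (fun x => φ0 x + φ x) ⊆ Ω :=
          (tsupport_add φ0 φ).trans (Set.union_subset h03 h3')
        have hs := glob (fun x => φ0 x + φ x) (h01.add h1) (h02.add h2) hsub
        have hnm : ¬ AEStronglyMeasurable (fun x => f x * (φ0 x + φ x)) volume := by
          intro h
          apply h0
          have h5 := h.sub hm
          refine h5.congr (Filter.Eventually.of_forall fun x => ?_)
          simp only [Pi.sub_apply]
          ring
        rw [integral_undef fun h => hnm h.1] at hs
        simp_rw [gradient_add_fun h01 h1, inner_add_right] at hs
        rw [integral_add (pair_test_integrable hpq hq hu h01 h02 h03)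
          (pair_test_integrable hpq hq hu h1 h2 h3'), z0, zero_add] at hs
        exact hs
      · rw [glob φ h1 h2 h3']
        exact integral_undef fun h => hm h.1
    · intro i h hh hhR
      simp [Real.zero_rpow hp0.ne']

theorem local_int {p q α r : ℝ} (hpq : p.HolderConjugate q) (hq : 2 ≤ q) (hα0 : 0 < α) (hα1 : α < 1)
    (hr0 : 0 < r) (hr : 2 * r / q < 4 / (1 - α))
    {Ω : Set (EuclideanSpace ℝ (Fin 2))} (hΩ : IsOpen Ω)
    {u f : EuclideanSpace ℝ (Fin 2) → ℝ} {Du : EuclideanSpace ℝ (Fin 2) → EuclideanSpace ℝ (Fin 2)}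
    (hu : MemW1Loc 2 q Ω u Du) (hsol : IsLocalWeakSolution 2 q Ω Du f)
    (hf : MemBesovLoc 2 p α Ω f) {z : EuclideanSpace ℝ (Fin 2)} (hz : z ∈ Ω) :
    ∃ s ∈ nhds z, IntegrableOn (fun x => ‖Du x‖ ^ r) s volume := by
  obtain ⟨ε, hε, hεs⟩ := Metric.isOpen_iff.1 hΩ z hz
  obtain ⟨R, hR, hR1, hRs⟩ : ∃ R : ℝ, 0 < R ∧ R ≤ 1 ∧ closedBall z (5 * R) ⊆ Ω := by
    refine ⟨min 1 (ε / 6), by positivity, min_le_left _ _, ?_⟩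
    refine (closedBall_subset_ball ?_).trans hεs
    have := min_le_right 1 (ε / 6)
    linarith
  obtain ⟨F, M, hF, hFs, hFb⟩ := rhs_data hpq hq hu hsol hf hR hRs
  have hball : ball z (4 * R) ⊆ Ω :=
    (ball_subset_closedBall.trans (closedBall_subset_closedBall (by linarith))).trans hRs
  have hK := hu.1 (closedBall z (4 * R)) (isCompact_closedBall z _)
    ((closedBall_subset_closedBall (by linarith)).trans hRs)
  have hU : MemLp ((ball z (4 * R)).indicator u) (ENNReal.ofReal q) volume :=
    (memLp_indicator_iff_restrict measurableSet_ball).2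
      (hK.1.mono_measure (Measure.restrict_mono_set _ ball_subset_closedBall))
  have hD : MemLp ((ball z (4 * R)).indicator Du) (ENNReal.ofReal q) volume :=
    (memLp_indicator_iff_restrict measurableSet_ball).2
      (hK.2.mono_measure (Measure.restrict_mono_set _ ball_subset_closedBall))
  have hmain := core hpq hq hα0 hα1 hr0 hr hR hR1 (z := z) hU hD hF (by
      intro φ h1 h2 h3
      have h3' := h3.trans hball
      have := hu.2 φ h1 h2 h3'
      rw [setIntegral_eq_integral_of_forall_compl_eq_zero (fun x hx => by
        rw [gradient_zero_off fun h => hx (h3' h), smul_zero]),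
        setIntegral_eq_integral_of_forall_compl_eq_zero (fun x hx => by
        rw [image_eq_zero_of_notMem_tsupport fun h => hx (h3' h), zero_smul])] at this
      have e1 : (fun x => (ball z (4 * R)).indicator u x • gradient φ x) = fun x => u x • gradient φ x := by
        funext x
        by_cases hx : x ∈ ball z (4 * R)
        · rw [Set.indicator_of_mem hx]
        · rw [gradient_zero_off fun h => hx (h3 h), smul_zero, smul_zero]
      have e2 : (fun x => φ x • (ball z (4 * R)).indicator Du x) = fun x => φ x • Du x := by
        funext x
        by_cases hx : x ∈ ball z (4 * R)
        · rw [Set.indicator_of_mem hx]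
        · rw [image_eq_zero_of_notMem_tsupport fun h => hx (h3 h), zero_smul, zero_smul]
      rw [e1, e2]; exact this) (by
      intro φ h1 h2 h3
      rw [← hFs φ h1 h2 h3]
      congr 1
      funext x
      by_cases hx : x ∈ ball z (4 * R)
      · rw [Set.indicator_of_mem hx]
      · rw [gradient_zero_off fun h => hx (h3 h), inner_zero_right, inner_zero_right]) hFb
  refine ⟨ball z (R / 2), ball_mem_nhds z (by positivity), ?_⟩
  refine hmain.congr_fun (fun x hx => ?_) measurableSet_ball
  have : x ∈ ball z (4 * R) := ball_subset_ball (by linarith) hx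
  simp only [Set.indicator_of_mem this]

/-- **Remark (two-dimensional case, `q ≥ 2`).**  Let `n = 2`, `q ≥ 2`, `p = q/(q−1)`, and
let `u ∈ W^{1,q}_loc(Ω)` be a local weak solution of `−div((|∇u|−1)_+^{q−1}∇u/|∇u|) = f`
on a bounded open set `Ω ⊂ ℝ²`.  Then for every `r > 2q`, with `δ = 1 − 2q/r ∈ (0,1)`:
if `α ∈ (δ, 1)` and `f ∈ B^α_{p,∞,loc}(Ω)`, then `∇u ∈ L^r_loc(Ω)`. -/
theorem stmt19 (q p : ℝ) (hq : 2 ≤ q) (hp : p = q / (q - 1))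
    (Ω : Set (EuclideanSpace ℝ (Fin 2))) (hΩo : IsOpen Ω) (hΩb : Bornology.IsBounded Ω)
    (u f : EuclideanSpace ℝ (Fin 2) → ℝ)
    (Du : EuclideanSpace ℝ (Fin 2) → EuclideanSpace ℝ (Fin 2))
    (hu : MemW1Loc 2 q Ω u Du)
    (hsol : IsLocalWeakSolution 2 q Ω Du f) :
    ∀ r : ℝ, 2 * q < r →
      ∀ α : ℝ, 1 - 2 * q / r < α → α < 1 →
        MemBesovLoc 2 p α Ω f →
          ∀ K : Set (EuclideanSpace ℝ (Fin 2)), IsCompact K → K ⊆ Ω →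
            IntegrableOn (fun x => ‖Du x‖ ^ r) K volume := by
  intro r hr α hα hα1 hf K hK hKΩ
  have hq0 : 0 < q := by linarith
  have hr0 : 0 < r := by linarith
  have hpq : p.HolderConjugate q := by
    rw [Real.holderConjugate_iff, hp]
    refine ⟨?_, ?_⟩
    · rw [lt_div_iff₀ (by linarith)]; linarith
    · rw [inv_div]; field_simp; ring
  have hα0 : 0 < α := by
    have : 2 * q / r < 1 := by rw [div_lt_one hr0]; exact hr
    linarith
  have hrα : 2 * r / q < 4 / (1 - α) := by
    have h1 : 1 - α < 2 * q / r := by linarith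
    rw [lt_div_iff₀ hr0] at h1
    rw [div_lt_div_iff₀ hq0 (by linarith)]
    linarith
  have hloc : LocallyIntegrableOn (fun x => ‖Du x‖ ^ r) K volume := by
    intro z hz
    obtain ⟨s, hs, hi⟩ := local_int hpq hq hα0 hα1 hr0 hrα hΩo hu hsol hf (hKΩ hz)
    exact ⟨s, mem_nhdsWithin_of_mem_nhds hs, hi⟩
  exact hloc.integrableOn_isCompact hK
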